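/- arXiv:2602.13381 — 8 statements merged into one kernel-verified Lean document; each statement's English description precedes it below -/
import Mathlib

section
/- Let X be a complex Banach space, n ∈ ℕ, ∅ ≠ D ⊆ ℤⁿ, f : D → X, and let Ω ⊆ (ℂ∖{0})ⁿ be an open subset of ℂⁿ such that the multidimensional Z-transform F_f is absolutely convergent at every point z ∈ Ω. Then the function z ↦ F_f(z) := Σ_{k∈D} f(k) z₁^{−k₁}⋯zₙ^{−kₙ} is holomorphic (complex analytic as a function of the n complex variables z₁,…,zₙ) on Ω. -/
/-- A family of power series whose coefficients are jointly absolutely summable at radius `r` can be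
summed termwise. -/
theorem HasFPowerSeriesOnBall.tsum_of_summable_norm {𝕜 E F ι : Type*} [NontriviallyNormedField 𝕜]
    [NormedAddCommGroup E] [NormedSpace 𝕜 E] [NormedAddCommGroup F] [NormedSpace 𝕜 F]
    [CompleteSpace F] {g : ι → E → F} {p : ι → FormalMultilinearSeries 𝕜 E F} {x : E} {r : NNReal}
    (hr : 0 < r) (hg : ∀ i, HasFPowerSeriesOnBall (g i) (p i) x r)
    (hp : Summable fun q : ι × ℕ => ‖p q.1 q.2‖ * (r : ℝ) ^ q.2) :
    HasFPowerSeriesOnBall (fun y => ∑' i, g i y) (fun m => ∑' i, p i m) x r := by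
  have hr0 : (0 : ℝ) < r := hr
  have hps : Summable fun q : ℕ × ι => ‖p q.2 q.1‖ * (r : ℝ) ^ q.1 :=
    (Equiv.prodComm ℕ ι).summable_iff.2 hp
  have hm : ∀ m, Summable fun i => ‖p i m‖ := by
    intro m
    have h : Summable fun i => ‖p i m‖ * (r : ℝ) ^ m := hps.prod_factor m
    exact (summable_mul_right_iff (pow_pos hr0 m).ne').1 h
  refine ⟨?_, ENNReal.coe_pos.2 hr, fun {y} hy => ?_⟩
  · refine FormalMultilinearSeries.le_radius_of_summable _ ?_
    have hsum : Summable fun m => (∑' i, ‖p i m‖) * (r : ℝ) ^ m := by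
      simpa only [tsum_mul_right] using hps.prod
    refine hsum.of_nonneg_of_le (fun m => by positivity) fun m => ?_
    exact mul_le_mul_of_nonneg_right (norm_tsum_le_tsum_norm (hm m)) (by positivity)
  · have hy' : ‖y‖ ≤ r := by
      have h : ‖y‖ < r := by simpa using hy
      exact h.le
    have hs : Summable fun q : ι × ℕ => p q.1 q.2 fun _ => y := by
      refine Summable.of_norm_bounded hp fun q => ?_
      calc ‖p q.1 q.2 fun _ => y‖ ≤ ‖p q.1 q.2‖ * ‖y‖ ^ q.2 := by
            simpa using (p q.1 q.2).le_opNorm fun _ => y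
        _ ≤ ‖p q.1 q.2‖ * (r : ℝ) ^ q.2 := by gcongr
    have h1 : HasSum (fun i => g i (x + y)) (∑' q : ι × ℕ, p q.1 q.2 fun _ => y) :=
      hs.hasSum.prod_fiberwise fun i => (hg i).hasSum hy
    have h2 : HasSum (fun q : ℕ × ι => p q.2 q.1 fun _ => y) (∑' q : ι × ℕ, p q.1 q.2 fun _ => y) :=
      (Equiv.prodComm ℕ ι).hasSum_iff.2 hs.hasSum
    have h3 : ∀ m, HasSum (fun i => p i m fun _ => y) ((∑' i, p i m) fun _ => y) := fun m =>
      ContinuousMultilinearMap.hasSum_eval (hm m).of_norm.hasSum fun _ => y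
    rw [h1.tsum_eq]
    exact h2.prod_fiberwise h3

/-- A sum of exponentials of continuous linear forms with sufficiently fast decaying vector
coefficients is analytic at the origin. -/
theorem analyticAt_tsum_exp_smul {E F ι : Type*} [NormedAddCommGroup E] [NormedSpace ℂ E]
    [NormedAddCommGroup F] [NormedSpace ℂ F] [CompleteSpace F] (a : ι → F) (L : ι → E →L[ℂ] ℂ)
    {r : NNReal} (hr : 0 < r) (h : Summable fun i => ‖a i‖ * Real.exp (r * ‖L i‖)) :
    AnalyticAt ℂ (fun w => ∑' i, Complex.exp (L i w) • a i) 0 := by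
  let p : ι → FormalMultilinearSeries ℂ E F := fun i =>
    (ContinuousLinearMap.toSpanSingleton ℂ (a i)).compFormalMultilinearSeries
      ((NormedSpace.expSeries ℂ ℂ).compContinuousLinearMap (L i))
  have hg : ∀ i, HasFPowerSeriesOnBall (fun w => Complex.exp (L i w) • a i) (p i) 0 r := by
    intro i
    have h0 : HasFPowerSeriesOnBall NormedSpace.exp (NormedSpace.expSeries ℂ ℂ) (L i 0) ⊤ := by
      rw [map_zero]
      exact NormedSpace.exp_hasFPowerSeriesOnBall
    have h1 := (ContinuousLinearMap.toSpanSingleton ℂ (a i)).comp_hasFPowerSeriesOnBall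
      h0.compContinuousLinearMap
    rw [← Complex.exp_eq_exp_ℂ] at h1
    refine h1.mono (ENNReal.coe_pos.2 hr) ?_
    rw [ENNReal.top_div_of_ne_top (by simp)]
    exact le_top
  have hbd : ∀ i m, ‖p i m‖ ≤ ‖a i‖ * (‖L i‖ ^ m / m.factorial) := by
    intro i m
    refine ContinuousMultilinearMap.opNorm_le_bound (by positivity) fun v => ?_
    have : p i m v = ((m.factorial : ℂ)⁻¹ * (List.ofFn fun j => L i (v j)).prod) • a i := by
      simp [p, NormedSpace.expSeries]
      rfl
    rw [this, norm_smul, norm_mul, norm_inv, Complex.norm_natCast, List.prod_ofFn, norm_prod]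
    have h2 : ∏ j, ‖L i (v j)‖ ≤ ‖L i‖ ^ m * ∏ j, ‖v j‖ := by
      calc ∏ j, ‖L i (v j)‖ ≤ ∏ j, (‖L i‖ * ‖v j‖) :=
            Finset.prod_le_prod (fun _ _ => norm_nonneg _) fun j _ => (L i).le_opNorm _
        _ = _ := by simp [Finset.prod_mul_distrib]
    calc (m.factorial : ℝ)⁻¹ * (∏ j, ‖L i (v j)‖) * ‖a i‖
        ≤ (m.factorial : ℝ)⁻¹ * (‖L i‖ ^ m * ∏ j, ‖v j‖) * ‖a i‖ := by gcongr
      _ = _ := by ring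
  have hexp : ∀ i, HasSum (fun m : ℕ => ‖a i‖ * ((r * ‖L i‖) ^ m / m.factorial))
      (‖a i‖ * Real.exp (r * ‖L i‖)) := by
    intro i
    rw [Real.exp_eq_exp_ℝ]
    have h0 := NormedSpace.expSeries_div_hasSum_exp ((r : ℝ) * ‖L i‖)
    exact h0.mul_left _
  have hp : Summable fun q : ι × ℕ => ‖p q.1 q.2‖ * (r : ℝ) ^ q.2 := by
    have hs : Summable fun q : ι × ℕ => ‖a q.1‖ * ((r * ‖L q.1‖) ^ q.2 / q.2.factorial) := by
      refine (summable_prod_of_nonneg fun q => by positivity).2 ⟨fun i => (hexp i).summable, ?_⟩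
      simpa only [fun i => (hexp i).tsum_eq] using h
    refine hs.of_nonneg_of_le (fun q => by positivity) fun q => ?_
    calc ‖p q.1 q.2‖ * (r : ℝ) ^ q.2
        ≤ ‖a q.1‖ * (‖L q.1‖ ^ q.2 / q.2.factorial) * (r : ℝ) ^ q.2 := by
          gcongr
          exact hbd _ _
      _ = _ := by ring
  exact (HasFPowerSeriesOnBall.tsum_of_summable_norm hr hg hp).analyticAt

/-- The exponential of an `ℓ¹` norm is bounded by the sum over all choices of signs. -/
theorem Real.exp_sum_abs_le {ι : Type*} [Fintype ι] [DecidableEq ι] (b : ι → ℝ) :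
    Real.exp (∑ i, |b i|) ≤ ∑ s : ι → ℤˣ, ∏ i, Real.exp ((s i : ℤ) * b i) := by
  have h := Finset.prod_univ_sum (fun _ : ι => (Finset.univ : Finset ℤˣ))
    fun i u => Real.exp (((u : ℤ) : ℝ) * b i)
  rw [Fintype.piFinset_univ] at h
  rw [← h, Real.exp_sum]
  refine Finset.prod_le_prod (fun _ _ => (Real.exp_pos _).le) fun i _ => ?_
  have hu : ∃ u : ℤˣ, |b i| = ((u : ℤ) : ℝ) * b i := by
    rcases abs_choice (b i) with h | h
    · exact ⟨1, by simp [h]⟩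
    · exact ⟨-1, by simp [h]⟩
  obtain ⟨u, hu⟩ := hu
  rw [hu]
  exact Finset.single_le_sum (f := fun u : ℤˣ => Real.exp (((u : ℤ) : ℝ) * b i))
    (fun _ _ => (Real.exp_pos _).le) (Finset.mem_univ u)



/-- If the multidimensional `Z`-transform of a vector-valued sequence is
absolutely convergent at every point of an open set `Ω ⊆ (ℂ∖{0})ⁿ`, then it defines a
holomorphic (analytic) function on `Ω`. -/
theorem zTransform_holomorphic
    (X : Type*) [NormedAddCommGroup X] [NormedSpace ℂ X] [CompleteSpace X]
    (n : ℕ) (hn : 1 ≤ n) (D : Set (Fin n → ℤ)) (hD : D.Nonempty)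
    (f : (Fin n → ℤ) → X) (Ω : Set (Fin n → ℂ)) (hΩopen : IsOpen Ω)
    (hΩ0 : ∀ z ∈ Ω, ∀ i, z i ≠ 0)
    (hconv : ∀ z ∈ Ω, Summable (fun k : D => ‖f k.1‖ * ∏ i, ‖z i‖ ^ (-(k.1 i)))) :
    AnalyticOnNhd ℂ (fun z : Fin n → ℂ => ∑' k : D, (∏ i, z i ^ (-(k.1 i))) • f k.1) Ω := by
  intro z hz
  have hz0 := hΩ0 z hz
  obtain ⟨r, hr, hrΩ⟩ : ∃ r : ℝ, 0 < r ∧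
      ∀ s : Fin n → ℤˣ, (fun i => z i * (Real.exp (r * (s i : ℤ)) : ℂ)) ∈ Ω := by
    have hev : ∀ᶠ t : ℝ in nhds 0, ∀ s : Fin n → ℤˣ,
        (fun i => z i * (Real.exp (t * (s i : ℤ)) : ℂ)) ∈ Ω := by
      refine Filter.eventually_all.2 fun s => ?_
      have hc : Continuous fun t : ℝ => fun i => z i * (Real.exp (t * (s i : ℤ)) : ℂ) := by
        fun_prop
      exact hc.continuousAt.eventually_mem (hΩopen.mem_nhds (by simpa using hz))
    obtain ⟨ε, hε, h⟩ := Metric.eventually_nhds_iff.1 hev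
    exact ⟨ε / 2, by positivity, h (by simp [abs_of_pos hε, hε])⟩
  let L : D → (Fin n → ℂ) →L[ℂ] ℂ := fun k =>
    ∑ i, (-(k.1 i : ℂ)) • ContinuousLinearMap.proj (R := ℂ) (φ := fun _ : Fin n => ℂ) i
  have hLapp : ∀ k w, L k w = ∑ i, -(k.1 i : ℂ) * w i := fun k w => by simp [L]
  have hL : ∀ k, ‖L k‖ ≤ ∑ i, |(k.1 i : ℝ)| := by
    intro k
    refine ContinuousLinearMap.opNorm_le_bound _ (by positivity) fun w => ?_
    rw [hLapp, Finset.sum_mul]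
    refine norm_sum_le_of_le _ fun i _ => ?_
    rw [norm_mul, norm_neg, Complex.norm_intCast]
    gcongr
    exact norm_le_pi_norm w i
  let a : D → X := fun k => (∏ i, z i ^ (-(k.1 i))) • f k.1
  have ha : ∀ k, ‖a k‖ = ‖f k.1‖ * ∏ i, ‖z i‖ ^ (-(k.1 i)) := fun k => by
    simp only [a, norm_smul, norm_prod, norm_zpow, mul_comm]
  have hsum : Summable fun k => ‖a k‖ * Real.exp (r.toNNReal * ‖L k‖) := by
    refine (summable_sum fun (s : Fin n → ℤˣ) (_ : s ∈ Finset.univ) =>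
      hconv _ (hrΩ s)).of_nonneg_of_le (fun k => by positivity) fun k => ?_
    rw [Real.coe_toNNReal _ hr.le]
    calc ‖a k‖ * Real.exp (r * ‖L k‖)
        ≤ ‖a k‖ * Real.exp (∑ i, |-(r * (k.1 i : ℝ))|) := by
          gcongr
          simp only [abs_neg, abs_mul, abs_of_pos hr, ← Finset.mul_sum]
          gcongr
          exact hL k
      _ ≤ ‖a k‖ * ∑ s : Fin n → ℤˣ, ∏ i, Real.exp ((s i : ℤ) * -(r * (k.1 i : ℝ))) := by
          gcongr
          exact Real.exp_sum_abs_le _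
      _ = _ := by
          rw [Finset.mul_sum]
          refine Finset.sum_congr rfl fun s _ => ?_
          rw [ha, mul_assoc, ← Finset.prod_mul_distrib]
          congr 1
          refine Finset.prod_congr rfl fun i _ => ?_
          rw [norm_mul, mul_zpow, Complex.norm_real, Real.norm_eq_abs, Real.abs_exp,
            ← Real.rpow_intCast (Real.exp _), ← Real.exp_mul]
          congr 2
          push_cast
          ring
  have hG := analyticAt_tsum_exp_smul a L (Real.toNNReal_pos.2 hr) hsum
  have hlog : AnalyticAt ℂ (fun (y : Fin n → ℂ) i => Complex.log (y i / z i)) z := by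
    refine AnalyticAt.pi fun i => ?_
    refine AnalyticAt.clog ?_ (by simp [hz0 i])
    exact (ContinuousLinearMap.proj (R := ℂ) (φ := fun _ : Fin n => ℂ) i).analyticAt z |>.div
      analyticAt_const (hz0 i)
  refine (hG.comp_of_eq hlog (by ext i; simp [hz0 i])).congr ?_
  filter_upwards [hΩopen.mem_nhds hz] with y hy
  refine tsum_congr fun k => ?_
  rw [hLapp, smul_smul, Complex.exp_sum, ← Finset.prod_mul_distrib]
  congr 1
  refine Finset.prod_congr rfl fun i _ => ?_
  have : -(k.1 i : ℂ) = ((-(k.1 i) : ℤ) : ℂ) := by push_cast; rfl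
  rw [this, Complex.exp_int_mul, Complex.exp_log (div_ne_zero (hΩ0 y hy i) (hz0 i)), ← mul_zpow,
    div_mul_cancel₀ _ (hz0 i)]
end

section
/- Let X be a complex Banach space, n ∈ ℕ, r_i > 0 and let D_i equal ℕ₀ or −ℕ₀ for each 1 ≤ i ≤ n. Let f_i : D_i → ℂ for 1 ≤ i ≤ n−1 and f_n : D_n → X, put D := D₁ × ⋯ × D_n and f(k₁,…,k_n) := f₁(k₁) ⋯ f_{n−1}(k_{n−1}) · f_n(k_n). Suppose there exist real numbers m_i > 0 with |f_i(k_i)| ≤ m_i r_i^{k_i} for all k_i ∈ D_i (1 ≤ i ≤ n−1) and a real constant M > 0 with ‖f_n(k_n)‖ ≤ M r_n^{k_n} for all k_n ∈ D_n. Set Ω := Ω₁ × ⋯ × Ω_n, where Ω_i := {z_i ∈ ℂ : |z_i| > r_i} if D_i = ℕ₀, and Ω_i := {z_i ∈ ℂ : 0 < |z_i| < r_i} if D_i = −ℕ₀. Then the multidimensional Z-transform of f is absolutely convergent at every z ∈ Ω and F_f(z₁,…,z_n) = F_{f₁}(z₁) ⋯ F_{f_{n−1}}(z_{n−1}) ·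 F_{f_n}(z_n) for all z ∈ Ω. -/
/-- A product of absolutely summable scalar families is absolutely summable over the product of
the index types, and its sum is the product of the sums. -/
theorem summable_norm_prod_and_tsum_prod_eq {R : Type*} [NormedField R] [CompleteSpace R] :
    ∀ {m : ℕ} {β : Fin m → Type*} (g : ∀ i, β i → R) (_ : ∀ i, Summable fun b => ‖g i b‖),
      (Summable fun k : ∀ i, β i => ‖∏ i, g i (k i)‖) ∧
        ∑' k : ∀ i, β i, ∏ i, g i (k i) = ∏ i, ∑' b, g i b
  | 0, β, g, _ => by
    refine ⟨Summable.of_finite, ?_⟩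
    simp [tsum_fintype]
  | m + 1, β, g, hg => by
    obtain ⟨hs, ht⟩ := summable_norm_prod_and_tsum_prod_eq (fun i => g i.succ) fun i => hg i.succ
    constructor
    · rw [← (Fin.consEquiv β).summable_iff]
      simpa [Function.comp_def, Fin.prod_univ_succ, Fin.consEquiv] using (hg 0).mul_norm hs
    · rw [Fin.prod_univ_succ, ← ht, tsum_mul_tsum_of_summable_norm (hg 0) hs,
        ← (Fin.consEquiv β).tsum_eq]
      simp [Fin.prod_univ_succ, Fin.consEquiv]

theorem summable_zpow_nonneg {a : ℝ} (ha : 0 ≤ a) (ha' : a < 1) :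
    Summable fun k : {k : ℤ | 0 ≤ k} => a ^ k.1 := by
  have e : Function.Bijective fun n : ℕ => (⟨n, by simp⟩ : {k : ℤ | 0 ≤ k}) :=
    ⟨fun a b h => by simpa using h, fun ⟨k, hk⟩ => by lift k to ℕ using hk; exact ⟨k, rfl⟩⟩
  rw [← (Equiv.ofBijective _ e).summable_iff]
  simpa [Function.comp_def] using summable_geometric_of_lt_one ha ha'

theorem summable_zpow_nonpos {a : ℝ} (ha : 1 < a) :
    Summable fun k : {k : ℤ | k ≤ 0} => a ^ k.1 := by
  have e : Function.Bijective
      fun k : {k : ℤ | 0 ≤ k} => (⟨-k.1, Set.mem_ofPred.2 (neg_nonpos.2 k.2)⟩ : {k : ℤ | k ≤ 0}) :=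
    ⟨fun a b h => by simpa [Subtype.ext_iff] using h,
      fun ⟨k, hk⟩ => ⟨⟨-k, by simpa using hk⟩, by simp⟩⟩
  rw [← (Equiv.ofBijective _ e).summable_iff]
  simpa [Function.comp_def] using
    summable_zpow_nonneg (inv_nonneg.2 (zero_le_one.trans ha.le)) (inv_lt_one_of_one_lt₀ ha)

/-- Absolute convergence of the one-variable `Z`-transform of a sequence with
`‖g k‖ ≤ M * r ^ k`. -/
theorem summable_norm_zpow_neg_smul {E : Type*} [NormedAddCommGroup E] [NormedSpace ℂ E]
    {S : Set ℤ} {Ω : Set ℂ} {r M : ℝ} (hr : 0 < r)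
    (hcase : (S = {k : ℤ | 0 ≤ k} ∧ Ω = {z : ℂ | r < ‖z‖}) ∨
      (S = {k : ℤ | k ≤ 0} ∧ Ω = {z : ℂ | 0 < ‖z‖ ∧ ‖z‖ < r}))
    {g : ℤ → E} (hb : ∀ k ∈ S, ‖g k‖ ≤ M * r ^ k) {z : ℂ} (hz : z ∈ Ω) :
    Summable fun k : S => ‖z ^ (-k.1) • g k.1‖ := by
  have hgeom : Summable fun k : S => (r / ‖z‖) ^ k.1 := by
    rcases hcase with ⟨rfl, rfl⟩ | ⟨rfl, rfl⟩
    · exact summable_zpow_nonneg (by positivity) ((div_lt_one (hr.trans hz)).2 hz)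
    · exact summable_zpow_nonpos ((one_lt_div hz.1).2 hz.2)
  refine (hgeom.mul_left M).of_nonneg_of_le (fun _ => norm_nonneg _) fun k => ?_
  calc ‖z ^ (-k.1) • g k.1‖ = ‖z‖ ^ (-k.1) * ‖g k.1‖ := by rw [norm_smul, norm_zpow]
    _ ≤ ‖z‖ ^ (-k.1) * (M * r ^ k.1) := by gcongr; exact hb _ k.2
    _ = M * (r / ‖z‖) ^ k.1 := by rw [div_zpow, zpow_neg]; ring

/-- Integer vectors whose coordinates lie in prescribed sets, split off at the last coordinate. -/
def initLastEquiv {m : ℕ} (S : Fin m → Set ℤ) (T : Set ℤ) :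
    ((∀ i, S i) × T) ≃
      {k : Fin (m + 1) → ℤ | (∀ i : Fin m, k i.castSucc ∈ S i) ∧ k (Fin.last m) ∈ T} where
  toFun p := ⟨Fin.snoc (α := fun _ => ℤ) (fun i => (p.1 i).1) p.2.1, by simp⟩
  invFun k := (fun i => ⟨k.1 i.castSucc, k.2.1 i⟩, ⟨k.1 (Fin.last m), k.2.2⟩)
  left_inv p := by simp
  right_inv k := Subtype.ext (Fin.snoc_init_self k.1)


/-- Separation of variables in the multidimensional `Z`-transform under
exponential bounds: each `Dᵢ` equals `ℕ₀` or `-ℕ₀`, the factors satisfy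
`|fᵢ(kᵢ)| ≤ mᵢ rᵢ^{kᵢ}` and `‖fₙ(kₙ)‖ ≤ M rₙ^{kₙ}`, and `Ω = Ω₁ × ⋯ × Ωₙ` with
`Ωᵢ = {|zᵢ| > rᵢ}` in the first case and `Ωᵢ = {0 < |zᵢ| < rᵢ}` in the second.
(Here the dimension is `n = m + 1`.) -/
theorem zTransform_separation_of_variables_bounded
    (X : Type*) [NormedAddCommGroup X] [NormedSpace ℂ X] [CompleteSpace X]
    (m : ℕ) (r : Fin (m + 1) → ℝ) (hr : ∀ i, 0 < r i)
    (Ds : Fin m → Set ℤ) (Dv : Set ℤ)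
    (Ωs : Fin m → Set ℂ) (Ωv : Set ℂ)
    (hcase : ∀ i : Fin m,
      (Ds i = {k : ℤ | 0 ≤ k} ∧ Ωs i = {z : ℂ | r i.castSucc < ‖z‖}) ∨
      (Ds i = {k : ℤ | k ≤ 0} ∧ Ωs i = {z : ℂ | 0 < ‖z‖ ∧ ‖z‖ < r i.castSucc}))
    (hcasev :
      (Dv = {k : ℤ | 0 ≤ k} ∧ Ωv = {z : ℂ | r (Fin.last m) < ‖z‖}) ∨
      (Dv = {k : ℤ | k ≤ 0} ∧ Ωv = {z : ℂ | 0 < ‖z‖ ∧ ‖z‖ < r (Fin.last m)}))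
    (fs : Fin m → ℤ → ℂ) (fv : ℤ → X)
    (ms : Fin m → ℝ) (hms : ∀ i, 0 < ms i)
    (hbs : ∀ i : Fin m, ∀ k ∈ Ds i, ‖fs i k‖ ≤ ms i * r i.castSucc ^ k)
    (M : ℝ) (hM : 0 < M)
    (hbv : ∀ k ∈ Dv, ‖fv k‖ ≤ M * r (Fin.last m) ^ k)
    (D : Set (Fin (m + 1) → ℤ))
    (hD : D = {k | (∀ i : Fin m, k i.castSucc ∈ Ds i) ∧ k (Fin.last m) ∈ Dv})
    (f : (Fin (m + 1) → ℤ) → X)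
    (hf : ∀ k, f k = (∏ i : Fin m, fs i (k i.castSucc)) • fv (k (Fin.last m)))
    (Ω : Set (Fin (m + 1) → ℂ))
    (hΩ : Ω = {z | (∀ i : Fin m, z i.castSucc ∈ Ωs i) ∧ z (Fin.last m) ∈ Ωv}) :
    ∀ z ∈ Ω,
      Summable (fun k : D => ‖f k.1‖ * ∏ i, ‖z i‖ ^ (-(k.1 i))) ∧
      ∑' k : D, (∏ i, z i ^ (-(k.1 i))) • f k.1
        = (∏ i : Fin m, ∑' ki : Ds i, fs i ki.1 * (z i.castSucc) ^ (-ki.1)) •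
            ∑' kn : Dv, (z (Fin.last m)) ^ (-kn.1) • fv kn.1 := by
  subst hD hΩ
  rintro z ⟨hzs, hzv⟩
  have hs (i : Fin m) : Summable fun k : Ds i => ‖fs i k.1 * z i.castSucc ^ (-k.1)‖ := by
    simpa [mul_comm] using
      summable_norm_zpow_neg_smul (hr i.castSucc) (hcase i) (hbs i) (hzs i)
  have hv := summable_norm_zpow_neg_smul (hr (Fin.last m)) hcasev hbv hzv
  obtain ⟨hp, hpt⟩ := summable_norm_prod_and_tsum_prod_eq
    (fun i (k : Ds i) => fs i k.1 * z i.castSucc ^ (-k.1)) hs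
  have hterm (p : (∀ i, Ds i) × Dv) :
      (∏ i, z i ^ (-((initLastEquiv Ds Dv p).1 i))) • f (initLastEquiv Ds Dv p).1 =
        (∏ i, fs i (p.1 i).1 * z i.castSucc ^ (-(p.1 i).1)) •
          z (Fin.last m) ^ (-p.2.1) • fv p.2.1 := by
    simp only [hf, initLastEquiv, Equiv.coe_fn_mk, Fin.prod_univ_castSucc, Fin.snoc_castSucc,
      Fin.snoc_last, smul_smul, Finset.prod_mul_distrib]
    congr 1
    ring
  have hnorm : Summable fun p : (∀ i, Ds i) × Dv =>
      ‖(∏ i, fs i (p.1 i).1 * z i.castSucc ^ (-(p.1 i).1)) •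
        z (Fin.last m) ^ (-p.2.1) • fv p.2.1‖ := by
    simpa only [norm_smul] using
      hp.mul_of_nonneg hv (fun _ => norm_nonneg _) (fun _ => norm_nonneg _)
  constructor
  · rw [← (initLastEquiv Ds Dv).summable_iff]
    refine hnorm.congr fun p => ?_
    rw [← hterm, norm_smul, norm_prod, mul_comm]
    simp only [norm_zpow, Function.comp_apply]
  · rw [← (initLastEquiv Ds Dv).tsum_eq, tsum_congr hterm, ← hpt]
    exact (tsum_smul_tsum hp.of_norm hv.of_norm hnorm.of_norm).symm
end

section
/- Let X be a complex Banach space, n ∈ ℕ, ∅ ≠ D ⊆ ℤⁿ, f : D → X, r_i > 0 for 1 ≤ i ≤ n, and let Ω ⊆ (ℂ∖{0})ⁿ contain an open neighborhood (in ℂⁿ) of the polytorus T := {z₁ ∈ ℂ : |z₁| = r₁} × ⋯ × {z_n ∈ ℂ : |z_n| = r_n}. Suppose the multidimensional Z-transform F_f is absolutely convergent at every z ∈ Ω. Then for every k = (k₁,…,k_n) ∈ D, f(k) = (1/(2πi)ⁿ) ∮_{|z₁|=r₁} ⋯ ∮_{|z_n|=r_n} z₁^{k₁−1} ⋯ z_n^{k_n−1}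 F_f(z₁,…,z_n) dz₁ ⋯ dz_n, where the iterated contour integral is the torus integral over the polytorus T centered at 0 with radii r₁,…,r_n. -/
open MeasureTheory in
/-- The torus integral of a product of functions of one variable is the product of the
circle integrals. -/
theorem torusIntegral_prod_eq_prod_circleIntegral {n : ℕ} (g : Fin n → ℂ → ℂ) (c : Fin n → ℂ)
    (R : Fin n → ℝ) :
    (∯ z in T(c, R), ∏ i, g i (z i)) = ∏ i, ∮ z in C(c i, R i), g i z := by
  simp only [torusIntegral, torusMap, circleIntegral_def_Icc, smul_eq_mul,
    ← Finset.prod_mul_distrib]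
  rw [← Set.pi_univ_Icc, volume_pi, Measure.restrict_pi_pi]
  rw [integral_fintype_prod_eq_prod (𝕜 := ℂ)
    (f := fun i (t : ℝ) => R i * Complex.exp (t * Complex.I) * Complex.I *
      g i (c i + R i * Complex.exp (t * Complex.I)))]
  simp [circleMap, deriv_circleMap]

/-- The torus integral of a series that is dominated on the torus by a summable family of
constants may be computed termwise. -/
theorem hasSum_torusIntegral_of_summable_bound {E ι : Type*} [NormedAddCommGroup E]
    [NormedSpace ℂ E] [CompleteSpace E] [Countable ι] {n : ℕ} {F : ι → (Fin n → ℂ) → E}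
    {c : Fin n → ℂ} {R : Fin n → ℝ} {b : ι → ℝ} (hF : ∀ j, TorusIntegrable (F j) c R)
    (hb : Summable b) (hle : ∀ j θ, ‖F j (torusMap c R θ)‖ ≤ b j) :
    HasSum (fun j => ∯ z in T(c, R), F j z) (∯ z in T(c, R), ∑' j, F j z) := by
  have hsum : ∀ θ, Summable fun j => F j (torusMap c R θ) := fun θ =>
    .of_norm_bounded hb fun j => hle j θ
  refine MeasureTheory.hasSum_integral_of_dominated_convergence
    (fun j _ => (∏ i, |R i|) * b j) (fun j => (hF j).function_integrable.1)
    (fun j => .of_forall fun θ => ?_) (.of_forall fun _ => hb.mul_left _) ?_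
    (.of_forall fun θ => (hsum θ).hasSum.const_smul _)
  · rw [norm_smul]
    simp only [norm_prod, norm_mul, Complex.norm_real, Complex.norm_exp_ofReal_mul_I,
      Complex.norm_I, mul_one, Real.norm_eq_abs]
    gcongr
    exact hle j θ
  · exact continuous_const.integrableOn_Icc

theorem circleIntegral_zpow {r : ℝ} (hr : 0 < r) (m : ℤ) :
    (∮ z in C(0, r), z ^ m) = if m = -1 then 2 * (Real.pi : ℂ) * Complex.I else 0 := by
  split_ifs with h
  · simpa [h] using circleIntegral.integral_sub_center_inv (0 : ℂ) hr.ne'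
  · simpa using circleIntegral.integral_sub_zpow_of_ne h (0 : ℂ) 0 r

/-- Laurent monomials are orthogonal on a polytorus. -/
theorem torusIntegral_prod_zpow_mul_prod_zpow {n : ℕ} {r : Fin n → ℝ} (hr : ∀ i, 0 < r i)
    (k l : Fin n → ℤ) :
    (∯ z in T(0, r), (∏ i, z i ^ (k i - 1)) * ∏ i, z i ^ (-(l i))) =
      if l = k then (2 * (Real.pi : ℂ) * Complex.I) ^ n else 0 := by
  have hmono : (∯ z in T(0, r), (∏ i, z i ^ (k i - 1)) * ∏ i, z i ^ (-(l i))) =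
      ∯ z in T(0, r), ∏ i, z i ^ (k i - 1 - l i) := by
    simp only [torusIntegral]
    congr! 3 with θ
    rw [← Finset.prod_mul_distrib]
    refine Finset.prod_congr rfl fun i _ => ?_
    rw [sub_eq_add_neg (k i - 1), zpow_add₀]
    simp [torusMap, (hr i).ne']
  rw [hmono, torusIntegral_prod_eq_prod_circleIntegral fun i w => w ^ (k i - 1 - l i)]
  simp only [Pi.zero_apply, circleIntegral_zpow (hr _)]
  split_ifs with h
  · simp [h]
  · obtain ⟨i, hi⟩ := Function.ne_iff.mp h
    exact Finset.prod_eq_zero (Finset.mem_univ i) (if_neg (by omega))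


/-- Inversion formula for the multidimensional vector-valued `Z`-transform:
if `F_f` converges absolutely on a set `Ω` containing an open neighborhood of the
polytorus `{|z₁| = r₁} × ⋯ × {|zₙ| = rₙ}`, then for every `k ∈ D`,
`f(k) = (1/(2πi)ⁿ) ∯_{T(0,r)} z₁^{k₁-1}⋯zₙ^{kₙ-1} F_f(z) dz`. -/
theorem zTransform_inversion_multidim
    (X : Type*) [NormedAddCommGroup X] [NormedSpace ℂ X] [CompleteSpace X]
    (n : ℕ) (hn : 1 ≤ n) (D : Set (Fin n → ℤ)) (hD : D.Nonempty)
    (f : (Fin n → ℤ) → X) (r : Fin n → ℝ) (hr : ∀ i, 0 < r i)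
    (Ω : Set (Fin n → ℂ)) (hΩ0 : ∀ z ∈ Ω, ∀ i, z i ≠ 0)
    (hnbhd : ∃ U : Set (Fin n → ℂ), IsOpen U ∧
      {z : Fin n → ℂ | ∀ i, ‖z i‖ = r i} ⊆ U ∧ U ⊆ Ω)
    (hconv : ∀ z ∈ Ω, Summable (fun k : D => ‖f k.1‖ * ∏ i, ‖z i‖ ^ (-(k.1 i)))) :
    ∀ k ∈ D,
      f k = ((2 * (Real.pi : ℂ) * Complex.I) ^ n)⁻¹ •
        ∯ z in T(0, r), (∏ i, z i ^ (k i - 1)) •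
          ∑' l : D, (∏ i, z i ^ (-(l.1 i))) • f l.1 := by
  intro k hk
  obtain ⟨U, -, hTU, hUΩ⟩ := hnbhd
  have hnorm (θ : Fin n → ℝ) (i : Fin n) : ‖torusMap 0 r θ i‖ = r i := by
    simp [torusMap, abs_of_pos (hr i)]
  have hsum : Summable fun l : D => ‖f l.1‖ * ∏ i, r i ^ (-(l.1 i)) := by
    simpa only [hnorm] using hconv (torusMap 0 r 0) (hUΩ (hTU (hnorm 0)))
  have hint (l : D) : TorusIntegrable
      (fun z => (∏ i, z i ^ (k i - 1)) • (∏ i, z i ^ (-(l.1 i))) • f l.1) 0 r := by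
    have hne (θ : Fin n → ℝ) (i : Fin n) : torusMap 0 r θ i ≠ 0 :=
      norm_ne_zero_iff.mp ((hnorm θ i).trans_ne (hr i).ne')
    have hcont (i : Fin n) (m : ℤ) : Continuous fun θ => torusMap 0 r θ i ^ m :=
      Continuous.zpow₀ (by unfold torusMap; fun_prop) m fun θ => .inl (hne θ i)
    refine Continuous.integrableOn_Icc ?_
    exact (continuous_finsetProd _ fun i _ => hcont i _).smul
      ((continuous_finsetProd _ fun i _ => hcont i _).smul continuous_const)
  have hHas := hasSum_torusIntegral_of_summable_bound hint
    (hsum.mul_left (∏ i, r i ^ (k i - 1))) fun l θ => by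
      simp only [norm_smul, norm_prod, norm_zpow, hnorm]
      rw [mul_comm ‖f l.1‖]
  have hterm (l : D) :
      (∯ z in T(0, r), (∏ i, z i ^ (k i - 1)) • (∏ i, z i ^ (-(l.1 i))) • f l.1) =
        if l = ⟨k, hk⟩ then (2 * (Real.pi : ℂ) * Complex.I) ^ n • f k else 0 := by
    have := torusIntegral_prod_zpow_mul_prod_zpow hr k l.1
    simp only [torusIntegral, smul_smul] at this ⊢
    rw [integral_smul_const]
    simp only [smul_eq_mul] at this
    rw [this]
    simp only [Subtype.ext_iff]
    split_ifs with h <;> simp [h]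
  simp only [hterm, tsum_const_smul''] at hHas
  rw [hHas.unique (hasSum_ite_eq _ _), inv_smul_smul₀]
  exact pow_ne_zero _ Complex.two_pi_I_ne_zero
end

section
/- Let X be a complex Banach space, n ∈ ℕ, ∅ ≠ D' ⊆ ℤⁿ, ∅ ≠ D'' ⊆ ℤⁿ, a : D' → ℂ, b : D'' → X, D := D' + D'' := {k + l : k ∈ D', l ∈ D''}, and ∅ ≠ Ω ⊆ (ℂ∖{0})ⁿ. Suppose that for every z = (z₁,…,z_n) ∈ Ω: Σ_{s∈D'} |a(s)| |z₁|^{−s₁}⋯|z_n|^{−s_n} < ∞ and Σ_{l∈D''} ‖b(l)‖ |z₁|^{−l₁}⋯|z_n|^{−l_n} < ∞. Then: (1) for every k ∈ D the series (a ∗_D b)(k) := Σ_{l∈D'', k−l∈D'} a(k−l) b(l) converges absolutely; (2) the multidimensional Z-transform of (a ∗_D b) (as a function on D) is absolutely convergent at every z ∈ Ω; and (3) F_{a∗_D b}(z) = F_a(z) · F_b(z) for all z ∈ Ω. -/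
open scoped Pointwise

/-- Pairs `(s, l) ∈ D' × D''` grouped by their sum `k = s + l`. -/
def Set.sigmaAddEquivProd {G : Type*} [AddCommGroup G] (D' D'' : Set G) :
    (Σ k : ↥(D' + D''), {l : G // l ∈ D'' ∧ k.1 - l ∈ D'}) ≃ D' × D'' where
  toFun p := (⟨p.1.1 - p.2.1, p.2.2.2⟩, ⟨p.2.1, p.2.2.1⟩)
  invFun q := ⟨⟨q.1.1 + q.2.1, Set.add_mem_add q.1.2 q.2.2⟩,
    ⟨q.2.1, q.2.2, by simp⟩⟩
  left_inv := by
    rintro ⟨⟨k, hk⟩, ⟨l, hl, hkl⟩⟩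
    dsimp only at hkl
    obtain ⟨s, rfl⟩ : ∃ s, k = s + l := ⟨k - l, by simp⟩
    ext <;> simp
  right_inv := by
    rintro ⟨⟨s, hs⟩, ⟨l, hl⟩⟩
    simp

section Convolution

variable {G X : Type*} [AddCommGroup G] [NormedAddCommGroup X] [NormedSpace ℂ X]
  {D' D'' : Set G} {u : G → ℂ} {v : G → X}

theorem summable_sigma_norm_convolution
    (hu : Summable fun s : D' => ‖u s‖) (hv : Summable fun l : D'' => ‖v l‖) :
    Summable fun p : Σ k : ↥(D' + D''), {l : G // l ∈ D'' ∧ k.1 - l ∈ D'} =>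
      ‖u (p.1.1 - p.2.1) • v p.2.1‖ := by
  have h := hu.mul_of_nonneg hv (fun _ => norm_nonneg _) (fun _ => norm_nonneg _)
  simp only [norm_smul]
  exact (Set.sigmaAddEquivProd D' D'').summable_iff.mpr h

theorem summable_norm_tsum_convolution
    (hu : Summable fun s : D' => ‖u s‖) (hv : Summable fun l : D'' => ‖v l‖) :
    Summable fun k : ↥(D' + D'') =>
      ‖∑' l : {l : G // l ∈ D'' ∧ k.1 - l ∈ D'}, u (k.1 - l.1) • v l.1‖ := by
  have h := summable_sigma_norm_convolution hu hv
  exact h.sigma.of_nonneg_of_le (fun _ => norm_nonneg _)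
    fun k => norm_tsum_le_tsum_norm (h.sigma_factor k)

theorem tsum_convolution [CompleteSpace X]
    (hu : Summable fun s : D' => ‖u s‖) (hv : Summable fun l : D'' => ‖v l‖) :
    ∑' (k : ↥(D' + D'')) (l : {l : G // l ∈ D'' ∧ k.1 - l ∈ D'}), u (k.1 - l.1) • v l.1
      = (∑' s : D', u s) • ∑' l : D'', v l := by
  have h := summable_sigma_norm_convolution hu hv
  have hprod : Summable fun q : D' × D'' => u q.1 • v q.2 :=
    (Set.sigmaAddEquivProd D' D'').summable_iff.mp h.of_norm
  rw [← h.of_norm.tsum_sigma, tsum_smul_tsum hu.of_norm hv.of_norm hprod]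
  exact (Set.sigmaAddEquivProd D' D'').tsum_eq fun q : D' × D'' => u q.1 • v q.2

end Convolution

/-- Convolution theorem for the multidimensional vector-valued `Z`-transform:
the discrete convolution `(a ∗_D b)(k) = ∑_{l ∈ D'', k-l ∈ D'} a(k-l) b(l)` is given by
absolutely convergent series, its `Z`-transform converges absolutely on `Ω`, and
`F_{a ∗ b}(z) = F_a(z)·F_b(z)`. -/
theorem zTransform_convolution
    (X : Type*) [NormedAddCommGroup X] [NormedSpace ℂ X] [CompleteSpace X]
    (n : ℕ) (hn : 1 ≤ n) (D' D'' : Set (Fin n → ℤ))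
    (hD' : D'.Nonempty) (hD'' : D''.Nonempty)
    (a : (Fin n → ℤ) → ℂ) (b : (Fin n → ℤ) → X)
    (Ω : Set (Fin n → ℂ)) (hΩ : Ω.Nonempty) (hΩ0 : ∀ z ∈ Ω, ∀ i, z i ≠ 0)
    (ha : ∀ z ∈ Ω, Summable (fun s : D' => ‖a s.1‖ * ∏ i, ‖z i‖ ^ (-(s.1 i))))
    (hb : ∀ z ∈ Ω, Summable (fun l : D'' => ‖b l.1‖ * ∏ i, ‖z i‖ ^ (-(l.1 i)))) :
    (∀ k ∈ D' + D'',
      Summable (fun l : {l : Fin n → ℤ // l ∈ D'' ∧ k - l ∈ D'} =>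
        ‖a (k - l.1)‖ * ‖b l.1‖)) ∧
    ∀ z ∈ Ω,
      Summable (fun k : ↥(D' + D'') =>
        ‖∑' l : {l : Fin n → ℤ // l ∈ D'' ∧ k.1 - l ∈ D'}, a (k.1 - l.1) • b l.1‖ *
          ∏ i, ‖z i‖ ^ (-(k.1 i))) ∧
      ∑' k : ↥(D' + D''), (∏ i, z i ^ (-(k.1 i))) •
          ∑' l : {l : Fin n → ℤ // l ∈ D'' ∧ k.1 - l ∈ D'}, a (k.1 - l.1) • b l.1
        = (∑' s : D', a s.1 * ∏ i, z i ^ (-(s.1 i))) •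
            ∑' l : D'', (∏ i, z i ^ (-(l.1 i))) • b l.1 := by
  have weight_sub : ∀ z ∈ Ω, ∀ k l : Fin n → ℤ,
      (∏ i, z i ^ (-((k - l) i))) * ∏ i, z i ^ (-(l i)) = ∏ i, z i ^ (-(k i)) := by
    intro z hz k l
    rw [← Finset.prod_mul_distrib]
    refine Finset.prod_congr rfl fun i _ => ?_
    rw [← zpow_add₀ (hΩ0 z hz i), Pi.sub_apply]
    congr 1
    ring
  have weight_ne : ∀ z ∈ Ω, ∀ k : Fin n → ℤ, ∏ i, z i ^ (-(k i)) ≠ 0 := fun z hz k =>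
    Finset.prod_ne_zero_iff.mpr fun i _ => zpow_ne_zero _ (hΩ0 z hz i)
  have norm_weight : ∀ (z : Fin n → ℂ) (k : Fin n → ℤ),
      ‖∏ i, z i ^ (-(k i))‖ = ∏ i, ‖z i‖ ^ (-(k i)) := by
    intro z k
    simp only [norm_prod, norm_zpow]
  have weighted_smul : ∀ z ∈ Ω, ∀ k l : Fin n → ℤ,
      (a (k - l) * ∏ i, z i ^ (-((k - l) i))) • (∏ i, z i ^ (-(l i))) • b l
        = (∏ i, z i ^ (-(k i))) • a (k - l) • b l := by
    intro z hz k l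
    rw [smul_smul, mul_assoc, weight_sub z hz, mul_comm, mul_smul]
  have hu : ∀ z ∈ Ω, Summable fun s : D' => ‖a s.1 * ∏ i, z i ^ (-(s.1 i))‖ := by
    intro z hz
    simpa only [norm_mul, norm_weight] using ha z hz
  have hv : ∀ z ∈ Ω, Summable fun l : D'' => ‖(∏ i, z i ^ (-(l.1 i))) • b l.1‖ := by
    intro z hz
    simpa only [norm_smul, norm_weight, mul_comm] using hb z hz
  refine ⟨fun k hk => ?_, fun z hz => ⟨?_, ?_⟩⟩
  · obtain ⟨z, hz⟩ := hΩ
    have h := (summable_sigma_norm_convolution (u := fun s => a s * ∏ i, z i ^ (-(s i)))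
      (v := fun l => (∏ i, z i ^ (-(l i))) • b l) (hu z hz) (hv z hz)).sigma_factor ⟨k, hk⟩
    simp only [weighted_smul z hz] at h
    simp only [norm_smul] at h
    exact (summable_mul_left_iff (norm_ne_zero_iff.mpr (weight_ne z hz k))).mp h
  · have h := summable_norm_tsum_convolution (u := fun s => a s * ∏ i, z i ^ (-(s i)))
      (v := fun l => (∏ i, z i ^ (-(l i))) • b l) (hu z hz) (hv z hz)
    simp only [weighted_smul z hz, tsum_const_smul''] at h
    simpa only [norm_smul, norm_weight, mul_comm] using h
  · have h := tsum_convolution (u := fun s => a s * ∏ i, z i ^ (-(s i)))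
      (v := fun l => (∏ i, z i ^ (-(l i))) • b l) (hu z hz) (hv z hz)
    simpa only [weighted_smul z hz, tsum_const_smul''] using h
end

section
/- Let X be a complex Banach space, n ∈ ℕ, 1 ≤ l ≤ n, and let 1 ≤ j₁ < j₂ < ⋯ < j_l ≤ n be fixed indices. Let a : D' → ℂ with ∅ ≠ D' ⊆ ℤˡ, and b : D'' → X with ∅ ≠ D'' ⊆ ℤⁿ. For k = (k₁,…,k_n) ∈ ℤⁿ let S_k be the set of all w = (w₁,…,w_l) ∈ ℤˡ such that (k_{j₁} − w₁, …, k_{j_l} − w_l) ∈ D' and the vector obtained from k by replacing the coordinate k_{j_i} with w_i for each 1 ≤ i ≤ l lies in D''; let D := {k ∈ ℤⁿ : S_k ≠ ∅} and suppose D ≠ ∅. Define (a ∗^{l,j} b)(k) := Σ_{w∈S_k} a(k_{j₁} − w₁, …, k_{j_l} − w_l) · b(k with coordinates j₁,…,j_l replaced by w₁,…,w_l). Let ∅ ≠ Ω ⊆ (ℂ∖{0})ⁿ be such that for every z = (z₁,…,z_n) ∈ Ω: Σ_{s∈D'} |a(s)| |z_{j₁}|^{−s₁}⋯|z_{j_l}|^{−s_l}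 < ∞ and Σ_{m∈D''} ‖b(m)‖ |z₁|^{−m₁}⋯|z_n|^{−m_n} < ∞. Then for every k ∈ D the defining series converges absolutely, the multidimensional Z-transform of (a ∗^{l,j} b) is absolutely convergent at every z ∈ Ω, and F_{a∗^{l,j}b}(z₁,…,z_n) = F_a(z_{j₁},…,z_{j_l}) · F_b(z₁,…,z_n) for all z ∈ Ω. -/
/-- Replace the coordinates `ι 0, …, ι (l-1)` of `k : ℤⁿ` by `w 0, …, w (l-1)`. -/
noncomputable def patchCoords {l n : ℕ} (ι : Fin l → Fin n) (k : Fin n → ℤ)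
    (w : Fin l → ℤ) : Fin n → ℤ :=
  fun i => if h : ∃ t, ι t = i then w h.choose else k i

section patchCoords

variable {l n : ℕ} {ι : Fin l → Fin n}

theorem patchCoords_apply (hι : Function.Injective ι) (k : Fin n → ℤ) (w : Fin l → ℤ)
    (t : Fin l) : patchCoords ι k w (ι t) = w t := by
  have h : ∃ t', ι t' = ι t := ⟨t, rfl⟩
  rw [patchCoords, dif_pos h, hι h.choose_spec]

theorem patchCoords_of_notMem_range (k : Fin n → ℤ) (w : Fin l → ℤ) {i : Fin n}
    (hi : i ∉ Set.range ι) : patchCoords ι k w i = k i :=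
  dif_neg hi

theorem patchCoords_patchCoords (hι : Function.Injective ι) (k : Fin n → ℤ)
    (w w' : Fin l → ℤ) : patchCoords ι (patchCoords ι k w) w' = patchCoords ι k w' := by
  funext i
  by_cases hi : i ∈ Set.range ι
  · obtain ⟨t, rfl⟩ := hi
    simp only [patchCoords_apply hι]
  · simp only [patchCoords_of_notMem_range _ _ hi]

theorem patchCoords_self (hι : Function.Injective ι) (k : Fin n → ℤ) :
    patchCoords ι k (fun t => k (ι t)) = k := by
  funext i
  by_cases hi : i ∈ Set.range ι
  · obtain ⟨t, rfl⟩ := hi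
    rw [patchCoords_apply hι]
  · rw [patchCoords_of_notMem_range _ _ hi]

/-- The monomial of exponent `-k` splits along the decomposition of `k` used in the
partial convolution. -/
theorem prod_zpow_neg_eq_mul_patchCoords {K : Type*} [Field K] (hι : Function.Injective ι)
    {z : Fin n → K} (hz : ∀ i, z i ≠ 0) (k : Fin n → ℤ) (w : Fin l → ℤ) :
    ∏ i, z i ^ (-(k i)) =
      (∏ t, z (ι t) ^ (-(k (ι t) - w t))) * ∏ i, z i ^ (-(patchCoords ι k w i)) := by
  rw [Fintype.prod_of_injective ι hι (fun t => z (ι t) ^ (-(k (ι t) - w t)))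
      (fun i => z i ^ (-(k i - patchCoords ι k w i)))
      (fun i hi => by simp [patchCoords_of_notMem_range k w hi])
      (fun t => by rw [patchCoords_apply hι]), ← Finset.prod_mul_distrib]
  refine Finset.prod_congr rfl fun i _ => ?_
  rw [← zpow_add₀ (hz i)]
  congr 1
  ring

/-- The pairs `(k, w)` occurring in the partial convolution correspond to the pairs of
indices of its two factors. -/
noncomputable def partialConvolutionEquiv (hι : Function.Injective ι) {D' : Set (Fin l → ℤ)}
    {D'' : Set (Fin n → ℤ)} {S : (Fin n → ℤ) → Set (Fin l → ℤ)}
    (hS : ∀ k, S k = {w : Fin l → ℤ |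
      (fun t => k (ι t) - w t) ∈ D' ∧ patchCoords ι k w ∈ D''})
    {D : Set (Fin n → ℤ)} (hD : D = {k | (S k).Nonempty}) :
    (Σ k : D, S k.1) ≃ D' × D'' where
  toFun p := (⟨fun t => p.1.1 (ι t) - p.2.1 t, ((hS _).subset p.2.2).1⟩,
    ⟨patchCoords ι p.1.1 p.2.1, ((hS _).subset p.2.2).2⟩)
  invFun q :=
    have h : (fun t => q.2.1 (ι t)) ∈
        S (patchCoords ι q.2.1 (fun t => q.2.1 (ι t) + q.1.1 t)) := by
      rw [hS]
      refine ⟨?_, ?_⟩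
      · simp only [patchCoords_apply hι, add_sub_cancel_left]
        exact q.1.2
      · rw [patchCoords_patchCoords hι, patchCoords_self hι]
        exact q.2.2
    ⟨⟨_, hD.superset ⟨_, h⟩⟩, ⟨_, h⟩⟩
  left_inv := by
    rintro ⟨⟨k, hk⟩, ⟨w, hw⟩⟩
    have hkw : patchCoords ι (patchCoords ι k w)
        (fun t => patchCoords ι k w (ι t) + (k (ι t) - w t)) = k := by
      simp only [patchCoords_patchCoords hι, patchCoords_apply hι, add_sub_cancel,
        patchCoords_self hι]
    have hw' : (fun t => patchCoords ι k w (ι t)) = w := by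
      simp only [patchCoords_apply hι]
    exact Sigma.subtype_ext (Subtype.ext hkw) hw'
  right_inv := by
    rintro ⟨⟨s, hs⟩, ⟨m, hm⟩⟩
    refine Prod.ext (Subtype.ext ?_) (Subtype.ext ?_)
    · simp only [patchCoords_apply hι, add_sub_cancel_left]
    · simp only [patchCoords_patchCoords hι, patchCoords_self hι]

end patchCoords

/-- `Z`-transform of the partial-variable discrete convolution product
`a ∗^{l,j} b`, where `a` acts in the variables `j₁ < ⋯ < j_l`:
`F_{a ∗^{l,j} b}(z₁,…,zₙ) = F_a(z_{j₁},…,z_{j_l}) · F_b(z₁,…,zₙ)` on `Ω`. -/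
theorem zTransform_partial_convolution
    (X : Type*) [NormedAddCommGroup X] [NormedSpace ℂ X] [CompleteSpace X]
    (n l : ℕ) (hl : 1 ≤ l) (hln : l ≤ n)
    (ι : Fin l → Fin n) (hι : StrictMono ι)
    (D' : Set (Fin l → ℤ)) (hD' : D'.Nonempty)
    (D'' : Set (Fin n → ℤ)) (hD'' : D''.Nonempty)
    (a : (Fin l → ℤ) → ℂ) (b : (Fin n → ℤ) → X)
    (S : (Fin n → ℤ) → Set (Fin l → ℤ))
    (hS : ∀ k, S k = {w : Fin l → ℤ |
      (fun t => k (ι t) - w t) ∈ D' ∧ patchCoords ι k w ∈ D''})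
    (D : Set (Fin n → ℤ)) (hDdef : D = {k | (S k).Nonempty}) (hDne : D.Nonempty)
    (Ω : Set (Fin n → ℂ)) (hΩ : Ω.Nonempty) (hΩ0 : ∀ z ∈ Ω, ∀ i, z i ≠ 0)
    (ha : ∀ z ∈ Ω, Summable (fun s : D' =>
      ‖a s.1‖ * ∏ t : Fin l, ‖z (ι t)‖ ^ (-(s.1 t))))
    (hb : ∀ z ∈ Ω, Summable (fun m : D'' =>
      ‖b m.1‖ * ∏ i, ‖z i‖ ^ (-(m.1 i)))) :
    (∀ k ∈ D, Summable (fun w : S k =>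
      ‖a (fun t => k (ι t) - w.1 t)‖ * ‖b (patchCoords ι k w.1)‖)) ∧
    ∀ z ∈ Ω,
      Summable (fun k : D =>
        ‖∑' w : S k.1, a (fun t => k.1 (ι t) - w.1 t) • b (patchCoords ι k.1 w.1)‖ *
          ∏ i, ‖z i‖ ^ (-(k.1 i))) ∧
      ∑' k : D, (∏ i, z i ^ (-(k.1 i))) •
          ∑' w : S k.1, a (fun t => k.1 (ι t) - w.1 t) • b (patchCoords ι k.1 w.1)
        = (∑' s : D', a s.1 * ∏ t : Fin l, z (ι t) ^ (-(s.1 t))) •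
            ∑' m : D'', (∏ i, z i ^ (-(m.1 i))) • b m.1 := by
  have hinj := hι.injective
  let e := partialConvolutionEquiv hinj hS hDdef
  have key : ∀ z ∈ Ω, Summable (fun p : Σ k : D, S k.1 => (∏ i, ‖z i‖ ^ (-(p.1.1 i))) *
      (‖a (fun t => p.1.1 (ι t) - p.2.1 t)‖ * ‖b (patchCoords ι p.1.1 p.2.1)‖)) := by
    intro z hz
    have hprod := (ha z hz).mul_of_nonneg (hb z hz) (fun _ => by positivity)
      (fun _ => by positivity)
    refine (e.summable_iff.mpr hprod).congr fun p => ?_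
    rw [prod_zpow_neg_eq_mul_patchCoords hinj (fun i => norm_ne_zero_iff.mpr (hΩ0 z hz i))
      p.1.1 p.2.1]
    simp only [Function.comp_apply, e, partialConvolutionEquiv, Equiv.coe_fn_mk]
    ring
  have hfiber : ∀ k : D, Summable (fun w : S k.1 =>
      ‖a (fun t => k.1 (ι t) - w.1 t)‖ * ‖b (patchCoords ι k.1 w.1)‖) := by
    intro k
    obtain ⟨z, hz⟩ := hΩ
    exact (summable_mul_left_iff (Finset.prod_ne_zero_iff.mpr fun i _ =>
      zpow_ne_zero (-(k.1 i)) (norm_ne_zero_iff.mpr (hΩ0 z hz i)))).mp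
      ((key z hz).sigma_factor k)
  refine ⟨fun k hk => hfiber ⟨k, hk⟩, fun z hz => ⟨?_, ?_⟩⟩
  · refine (key z hz).sigma.of_nonneg_of_le (fun k => by positivity) fun k => ?_
    dsimp only
    rw [tsum_mul_left, mul_comm]
    gcongr
    have hk := hfiber k
    simp only [← norm_smul] at hk ⊢
    exact norm_tsum_le_tsum_norm hk
  · have hG : Summable (fun p : Σ k : D, S k.1 => (∏ i, z i ^ (-(p.1.1 i))) •
        (a (fun t => p.1.1 (ι t) - p.2.1 t) • b (patchCoords ι p.1.1 p.2.1))) := by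
      refine Summable.of_norm ((key z hz).congr fun p => ?_)
      simp only [norm_smul, norm_prod, norm_zpow]
    have ha' : Summable (fun s : D' => ‖a s.1 * ∏ t : Fin l, z (ι t) ^ (-(s.1 t))‖) := by
      simpa only [norm_mul, norm_prod, norm_zpow] using ha z hz
    have hb' : Summable (fun m : D'' => ‖(∏ i, z i ^ (-(m.1 i))) • b m.1‖) := by
      simpa only [norm_smul, norm_prod, norm_zpow, mul_comm] using hb z hz
    have hab : Summable (fun q : D' × D'' => (a q.1.1 * ∏ t : Fin l, z (ι t) ^ (-(q.1.1 t))) •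
        ((∏ i, z i ^ (-(q.2.1 i))) • b q.2.1)) := by
      refine Summable.of_norm ((ha'.mul_of_nonneg hb' (fun _ => norm_nonneg _)
        (fun _ => norm_nonneg _)).congr fun q => ?_)
      simp only [norm_smul]
    rw [tsum_smul_tsum ha'.of_norm hb'.of_norm hab, ← e.tsum_eq]
    simp only [← tsum_const_smul'']
    rw [← hG.tsum_sigma]
    refine tsum_congr fun p => ?_
    rw [prod_zpow_neg_eq_mul_patchCoords hinj (hΩ0 z hz) p.1.1 p.2.1]
    simp only [e, partialConvolutionEquiv, Equiv.coe_fn_mk, smul_smul]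
    congr 1
    ring
end

section
/- Let X be a complex Banach space, n ∈ ℕ, let D ⊆ ℤⁿ be a finite nonempty set, let A_j be a bounded linear operator on X for each j ∈ D, and let f : ℤⁿ → X. Suppose there exists a nonempty open set Ω ⊆ (ℂ∖{0})ⁿ such that for every z = (z₁,…,z_n) ∈ Ω the bounded operator Σ_{j∈D} z₁^{j₁}⋯z_n^{j_n} A_j is injective. If u₁, u₂ : ℤⁿ → X both satisfy Σ_{j∈D} A_j u_i(k + j) = f(k) for all k ∈ ℤⁿ (i = 1, 2), and the multidimensional Z-transforms F_{u₁} and F_{u₂} are absolutely convergent at every z ∈ Ω, then u₁ = u₂. -/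
open scoped Topology

theorem dirichlet_tsum_eq_zero {ι E : Type*} [NormedAddCommGroup E] [NormedSpace ℂ E]
    [CompleteSpace E] {a : ι → E} {l : ι → ℝ} {δ : ℝ} (hδ : 0 < δ)
    (hpos : Summable fun k => ‖a k‖ * Real.exp (δ * l k))
    (hneg : Summable fun k => ‖a k‖ * Real.exp (-δ * l k))
    (hzero : ∀ᶠ s : ℂ in 𝓝 0, ∑' k, Complex.exp (s * l k) • a k = 0)
    {s : ℂ} (hs : s.re ∈ Set.Ioo (-δ) δ) :
    ∑' k, Complex.exp (s * l k) • a k = 0 := by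
  set U : Set ℂ := Complex.re ⁻¹' Set.Ioo (-δ) δ
  have hU : IsOpen U := isOpen_Ioo.preimage Complex.continuous_re
  have hconv : Convex ℝ U := (convex_Ioo (-δ) δ).linear_preimage Complex.reLm
  have hdiff : DifferentiableOn ℂ (fun s : ℂ => ∑' k, Complex.exp (s * l k) • a k) U := by
    refine Complex.differentiableOn_tsum_of_summable_norm (hpos.add hneg)
      (fun k => by fun_prop) hU fun k w hw => ?_
    have hw' : |w.re| ≤ δ := (abs_lt.2 hw).le
    have hexp : Real.exp (w.re * l k) ≤ Real.exp (δ * l k) + Real.exp (-δ * l k) := by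
      rcases le_total 0 (l k) with h | h
      · have := Real.exp_le_exp.2 (mul_le_mul_of_nonneg_right (abs_le.1 hw').2 h)
        linarith [Real.exp_pos (-δ * l k)]
      · have := Real.exp_le_exp.2 (mul_le_mul_of_nonpos_right (abs_le.1 hw').1 h)
        linarith [Real.exp_pos (δ * l k)]
    rw [norm_smul, Complex.norm_exp, Complex.re_mul_ofReal, mul_comm, ← mul_add]
    gcongr
  exact (hdiff.analyticOnNhd hU).eqOn_zero_of_preconnected_of_eventuallyEq_zero
    hconv.isPreconnected (z₀ := 0) (by simp [U, hδ]) hzero hs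

theorem integral_fourier (n : ℤ) :
    ∫ t : UnitAddCircle, fourier n t = if n = 0 then 1 else 0 := by
  split_ifs with h
  · simp [h, MeasureTheory.measureReal_def]
  · exact MeasureTheory.integral_eq_zero_of_add_right_eq_neg
      (fourier_add_half_inv_index h Fact.out)

theorem integral_mFourier {d : Type*} [Fintype d] (n : d → ℤ) :
    ∫ t, UnitAddTorus.mFourier n t = if n = 0 then 1 else 0 := by
  simp only [UnitAddTorus.mFourier, ContinuousMap.coe_mk]
  rw [MeasureTheory.integral_fintype_prod_volume_eq_prod
    fun i (t : UnitAddCircle) => fourier (n i) t]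
  simp only [integral_fourier, Finset.prod_ite_zero, funext_iff]
  simp

theorem eq_zero_of_tsum_mFourier_smul_eq_zero {d E : Type*} [Fintype d] [NormedAddCommGroup E]
    [NormedSpace ℂ E] [CompleteSpace E] {a : (d → ℤ) → E} (ha : Summable fun k => ‖a k‖)
    (hzero : ∀ t, ∑' k, UnitAddTorus.mFourier k t • a k = 0) : a = 0 := by
  funext m
  have hnorm (k : d → ℤ) (t : UnitAddTorus d) : ‖UnitAddTorus.mFourier k t‖ = 1 := by
    simp [UnitAddTorus.mFourier, norm_prod, Circle.norm_coe]
  have hsum := MeasureTheory.hasSum_integral_of_summable_integral_norm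
    (μ := (MeasureTheory.volume : MeasureTheory.Measure (UnitAddTorus d)))
    (F := fun (k : d → ℤ) t => UnitAddTorus.mFourier (k - m) t • a k)
    (fun k => ((UnitAddTorus.mFourier (k - m)).continuous.smul
      continuous_const).integrable_of_hasCompactSupport (HasCompactSupport.of_compactSpace _))
    (by simpa only [norm_smul, hnorm, one_mul, MeasureTheory.integral_const] using ha.const_smul _)
  have hfun (t : UnitAddTorus d) : ∑' k, UnitAddTorus.mFourier (k - m) t • a k = 0 := by
    simp_rw [sub_eq_add_neg, add_comm _ (-m), UnitAddTorus.mFourier_add, mul_smul]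
    rw [tsum_const_smul'' (UnitAddTorus.mFourier (-m) t), hzero, smul_zero]
  simp_rw [hfun, integral_smul_const, integral_mFourier, sub_eq_zero] at hsum
  simpa [eq_comm] using hsum.unique (hasSum_single m fun k hk => by simp [hk])

section Monomials

variable {n : ℕ} {E : Type*} [NormedAddCommGroup E] [NormedSpace ℂ E]

theorem norm_prod_zpow_smul (z : Fin n → ℂ) (k : Fin n → ℤ) (x : E) :
    ‖(∏ i, z i ^ (-(k i))) • x‖ = ‖x‖ * ∏ i, ‖z i‖ ^ (-(k i)) := by
  simp [norm_smul, norm_prod, mul_comm]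

theorem hasSum_pencil_tsum [CompleteSpace E] (D : Finset (Fin n → ℤ))
    (A : (Fin n → ℤ) → E →L[ℂ] E) {u : (Fin n → ℤ) → E} {z : Fin n → ℂ} (hz : ∀ i, z i ≠ 0)
    (hu : Summable fun k : Fin n → ℤ => ‖u k‖ * ∏ i, ‖z i‖ ^ (-(k i))) :
    HasSum (fun k : Fin n → ℤ => (∏ i, z i ^ (-(k i))) • ∑ j ∈ D, A j (u (k + j)))
      ((∑ j ∈ D, (∏ i, z i ^ (j i)) • A j) (∑' k, (∏ i, z i ^ (-(k i))) • u k)) := by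
  have hsum : HasSum (fun k : Fin n → ℤ => (∏ i, z i ^ (-(k i))) • u k) _ :=
    (Summable.of_norm (by simpa only [norm_prod_zpow_smul] using hu)).hasSum
  simp only [sum_apply, Finset.smul_sum]
  refine hasSum_sum fun j _ => ?_
  have hj := (Equiv.addRight j).hasSum_iff.2 (((∏ i, z i ^ (j i)) • A j).hasSum hsum)
  refine hj.congr_fun fun k => ?_
  simp only [Function.comp_apply, Equiv.coe_addRight, map_smul, smul_apply,
    smul_smul, ← Finset.prod_mul_distrib, Pi.add_apply]
  congr 1
  refine Finset.prod_congr rfl fun i _ => ?_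
  rw [← zpow_add₀ (hz i)]
  congr 1
  ring

theorem prod_zpow_mul_exp (w : Fin n → ℂ) (c : Fin n → ℝ) (s : ℂ) (k : Fin n → ℤ) :
    ∏ i, (w i * Complex.exp (-(s * c i))) ^ (-(k i)) =
      Complex.exp (s * ((∑ i, k i * c i : ℝ) : ℂ)) * ∏ i, w i ^ (-(k i)) := by
  simp only [mul_zpow, Finset.prod_mul_distrib, ← Complex.exp_int_mul, ← Complex.exp_sum]
  rw [mul_comm]
  congr 2
  push_cast
  rw [Finset.mul_sum]
  exact Finset.sum_congr rfl fun i _ => by ring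

theorem mFourier_coe_apply (k : Fin n → ℤ) (θ : Fin n → ℝ) :
    UnitAddTorus.mFourier k (fun i => (θ i : UnitAddCircle)) =
      Complex.exp (Complex.I * ((∑ i, k i * (2 * Real.pi * θ i) : ℝ) : ℂ)) := by
  simp only [UnitAddTorus.mFourier, ContinuousMap.coe_mk, fourier_coe_apply, ← Complex.exp_sum]
  push_cast
  rw [Finset.mul_sum]
  exact congrArg _ (Finset.sum_congr rfl fun i _ => by ring)

theorem eq_zero_of_zTransform_eq_zero [CompleteSpace E] {u : (Fin n → ℤ) → E}
    {Ω : Set (Fin n → ℂ)} (hΩne : Ω.Nonempty) (hΩopen : IsOpen Ω)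
    (hΩ0 : ∀ z ∈ Ω, ∀ i, z i ≠ 0)
    (hu : ∀ z ∈ Ω, Summable fun k : Fin n → ℤ => ‖u k‖ * ∏ i, ‖z i‖ ^ (-(k i)))
    (hzero : ∀ z ∈ Ω, ∑' k : Fin n → ℤ, (∏ i, z i ^ (-(k i))) • u k = 0) : u = 0 := by
  obtain ⟨w, hw⟩ := hΩne
  have ha : (fun k : Fin n → ℤ => (∏ i, w i ^ (-(k i))) • u k) = 0 := by
    refine eq_zero_of_tsum_mFourier_smul_eq_zero
      (by simpa only [norm_prod_zpow_smul] using hu w hw) fun t => ?_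
    obtain ⟨θ, rfl⟩ : ∃ θ : Fin n → ℝ, (fun i => (θ i : UnitAddCircle)) = t :=
      ⟨fun i => (t i).out, funext fun i => QuotientAddGroup.out_eq' (t i)⟩
    set c : Fin n → ℝ := fun i => 2 * Real.pi * θ i with hc
    have hcont : Continuous fun (s : ℂ) i => w i * Complex.exp (-(s * c i)) := by fun_prop
    have hev : ∀ᶠ s : ℂ in 𝓝 0, (fun i => w i * Complex.exp (-(s * c i))) ∈ Ω :=
      hcont.continuousAt.eventually_mem (hΩopen.mem_nhds (by simpa using hw))
    obtain ⟨ε, hε, hball⟩ := Metric.eventually_nhds_iff.1 hev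
    have hsum (r : ℝ) (hr : |r| < ε) : Summable fun k : Fin n → ℤ =>
        ‖(∏ i, w i ^ (-(k i))) • u k‖ * Real.exp (r * ∑ i, k i * c i) := by
      have h := hu _ (hball (y := (r : ℂ)) (by simpa using hr))
      simp_rw [← norm_prod_zpow_smul, prod_zpow_mul_exp, mul_smul] at h
      refine h.congr fun k => ?_
      rw [norm_smul _ (_ • u k), Complex.norm_exp, Complex.re_mul_ofReal, Complex.ofReal_re,
        mul_comm]
    simp only [mFourier_coe_apply]
    refine dirichlet_tsum_eq_zero (half_pos hε)
      (hsum _ (by rw [abs_of_pos] <;> linarith))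
      (hsum _ (by rw [abs_neg, abs_of_pos] <;> linarith)) ?_ (by simpa using hε)
    filter_upwards [hev] with s hs
    simpa only [prod_zpow_mul_exp, mul_smul] using hzero _ hs
  funext k
  exact (smul_eq_zero.1 (congrFun ha k)).resolve_left
    (Finset.prod_ne_zero_iff.2 fun i _ => zpow_ne_zero _ (hΩ0 w hw i))

end Monomials


/-- Uniqueness for the abstract linear difference equation
`∑_{j ∈ D} A_j u(k+j) = f(k)` on `ℤⁿ`: if there is a nonempty open set
`Ω ⊆ (ℂ∖{0})ⁿ` on which the operator pencil `∑_{j ∈ D} z^j A_j` is injective, then any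
two solutions whose multidimensional `Z`-transforms converge absolutely on `Ω` coincide. -/
theorem difference_equation_uniqueness
    (X : Type*) [NormedAddCommGroup X] [NormedSpace ℂ X] [CompleteSpace X]
    (n : ℕ) (hn : 1 ≤ n) (D : Set (Fin n → ℤ)) (hDne : D.Nonempty) (hDfin : D.Finite)
    (A : (Fin n → ℤ) → X →L[ℂ] X) (f u₁ u₂ : (Fin n → ℤ) → X)
    (Ω : Set (Fin n → ℂ)) (hΩne : Ω.Nonempty) (hΩopen : IsOpen Ω)
    (hΩ0 : ∀ z ∈ Ω, ∀ i, z i ≠ 0)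
    (hinj : ∀ z ∈ Ω, Function.Injective
      ⇑(∑ j ∈ hDfin.toFinset, (∏ i, z i ^ (j i)) • A j))
    (heq₁ : ∀ k, ∑ j ∈ hDfin.toFinset, A j (u₁ (k + j)) = f k)
    (heq₂ : ∀ k, ∑ j ∈ hDfin.toFinset, A j (u₂ (k + j)) = f k)
    (hZ₁ : ∀ z ∈ Ω, Summable (fun k : Fin n → ℤ => ‖u₁ k‖ * ∏ i, ‖z i‖ ^ (-(k i))))
    (hZ₂ : ∀ z ∈ Ω, Summable (fun k : Fin n → ℤ => ‖u₂ k‖ * ∏ i, ‖z i‖ ^ (-(k i)))) :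
    u₁ = u₂ := by
  have hZ : ∀ z ∈ Ω, Summable fun k : Fin n → ℤ => ‖(u₁ - u₂) k‖ * ∏ i, ‖z i‖ ^ (-(k i)) := by
    intro z hz
    refine ((hZ₁ z hz).add (hZ₂ z hz)).of_nonneg_of_le (fun k => by positivity) fun k => ?_
    rw [← add_mul]
    gcongr
    exact norm_sub_le _ _
  refine sub_eq_zero.1 (eq_zero_of_zTransform_eq_zero hΩne hΩopen hΩ0 hZ fun z hz => ?_)
  have h := hasSum_pencil_tsum hDfin.toFinset A (hΩ0 z hz) (hZ z hz)
  simp only [Pi.sub_apply, map_sub, Finset.sum_sub_distrib, heq₁, heq₂, sub_self,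
    smul_zero] at h
  exact hinj z hz ((h.unique hasSum_zero).trans (map_zero _).symm)
end

section
/- Let X be a complex Banach space, m ∈ ℕ, a : ℕ₀ → ℂ, u : ℤ → X, and let z ∈ ℂ∖{0} be such that Σ_{s=0}^{∞} |a(s)| |z|^{−s} < ∞ and Σ_{k∈ℤ} ‖u(k)‖ |z|^{−k} < ∞. Then: (1) for every k ∈ ℤ the series (Δ_{W,a}u)(k) := Σ_{s=0}^{∞} a(s) u(k−s) converges absolutely; (2) Σ_{k∈ℤ} ‖(Δ_{W,a}u)(k)‖ |z|^{−k} < ∞ and Σ_{k∈ℤ} ‖(Δ_{W,a,m}u)(k)‖ |z|^{−k} < ∞; and (3) the Z-transform of the generalized Weyl (a,m)-fractional derivative satisfies F_{Δ_{W,a,m}u}(z) = ( Σ_{j=0}^{m} (−1)^{m−j} C(m,j) z^{j} ) · F_a(z) · F_u(z), where F_a(z) = Σ_{s=0}^{∞} a(s) z^{−s}, F_u(z) = Σ_{k∈ℤ} u(k) z^{−k}, and C(m,j) is the binomial coefficient. -/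
section WeylConvolution

variable {X : Type*} [NormedAddCommGroup X] [NormedSpace ℂ X]

theorem hasSum_smul_of_summable_norm [CompleteSpace X] {ι κ : Type*} {f : ι → ℂ} {g : κ → X}
    (hf : Summable fun i => ‖f i‖) (hg : Summable fun k => ‖g k‖) :
    HasSum (fun p : ι × κ => f p.1 • g p.2) ((∑' i, f i) • ∑' k, g k) := by
  refine hf.of_norm.hasSum.smul hg.of_norm.hasSum (Summable.of_norm ?_)
  simp_rw [norm_smul]
  exact hf.mul_of_nonneg hg (fun _ => norm_nonneg _) fun _ => norm_nonneg _

/-- The weighted terms of the Weyl convolution, indexed by the output time and the lag. -/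
theorem zpow_neg_smul_weyl_term {z : ℂ} (hz : z ≠ 0) (a : ℕ → ℂ) (u : ℤ → X) (k : ℤ) (s : ℕ) :
    z ^ (-k) • a s • u (k - s) = (a s * z ^ (-(s : ℤ))) • z ^ (-(k - s)) • u (k - s) := by
  rw [smul_smul, smul_smul, mul_assoc, ← zpow_add₀ hz, mul_comm]
  congr 3
  ring

/-- The map `(k, s) ↦ (s, k - s)` as an equivalence. -/
def weylLagEquiv : ℤ × ℕ ≃ ℕ × ℤ where
  toFun p := (p.2, p.1 - p.2)
  invFun q := (q.2 + q.1, q.1)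
  left_inv p := by simp
  right_inv q := by simp

variable {z : ℂ} {a : ℕ → ℂ} {u : ℤ → X}

theorem summable_norm_weyl_terms (hz : z ≠ 0)
    (ha : Summable fun s : ℕ => ‖a s * z ^ (-(s : ℤ))‖)
    (hu : Summable fun k : ℤ => ‖z ^ (-k) • u k‖) :
    Summable fun p : ℤ × ℕ => ‖z ^ (-p.1) • a p.2 • u (p.1 - p.2)‖ := by
  have h := ha.mul_of_nonneg hu (fun _ => norm_nonneg _) (fun _ => norm_nonneg _)
  refine (weylLagEquiv.summable_iff.mpr h).congr fun p => ?_
  rw [zpow_neg_smul_weyl_term hz, norm_smul (a p.2 * _)]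
  rfl

theorem summable_norm_weyl_convolution (hz : z ≠ 0)
    (ha : Summable fun s : ℕ => ‖a s * z ^ (-(s : ℤ))‖)
    (hu : Summable fun k : ℤ => ‖z ^ (-k) • u k‖) :
    Summable fun k : ℤ => ‖z ^ (-k) • ∑' s : ℕ, a s • u (k - s)‖ := by
  have h := summable_norm_weyl_terms hz ha hu
  refine h.prod.of_nonneg_of_le (fun _ => norm_nonneg _) fun k => ?_
  rw [← tsum_const_smul'']
  exact norm_tsum_le_tsum_norm (h.prod_factor k)

theorem hasSum_weyl_convolution [CompleteSpace X] (hz : z ≠ 0)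
    (ha : Summable fun s : ℕ => ‖a s * z ^ (-(s : ℤ))‖)
    (hu : Summable fun k : ℤ => ‖z ^ (-k) • u k‖) :
    HasSum (fun k : ℤ => z ^ (-k) • ∑' s : ℕ, a s • u (k - s))
      ((∑' s : ℕ, a s * z ^ (-(s : ℤ))) • ∑' k : ℤ, z ^ (-k) • u k) := by
  have h := summable_norm_weyl_terms hz ha hu
  have hprod : HasSum (fun q : ℕ × ℤ => (a q.1 * z ^ (-(q.1 : ℤ))) • z ^ (-q.2) • u q.2)
      ((∑' s : ℕ, a s * z ^ (-(s : ℤ))) • ∑' k : ℤ, z ^ (-k) • u k) :=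
    hasSum_smul_of_summable_norm ha hu
  have hterms : HasSum (fun p : ℤ × ℕ => z ^ (-p.1) • a p.2 • u (p.1 - p.2))
      ((∑' s : ℕ, a s * z ^ (-(s : ℤ))) • ∑' k : ℤ, z ^ (-k) • u k) := by
    have hreindexed := weylLagEquiv.hasSum_iff.mpr hprod
    rw [show (fun p : ℤ × ℕ => z ^ (-p.1) • a p.2 • u (p.1 - p.2)) = _ from
      funext fun p => zpow_neg_smul_weyl_term hz a u p.1 p.2]
    exact hreindexed
  refine hterms.prod_fiberwise fun k => ?_
  rw [← tsum_const_smul'']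
  exact (h.of_norm.prod_factor k).hasSum

theorem zpow_neg_smul_shift (hz : z ≠ 0) (w : ℤ → X) (j k : ℤ) :
    z ^ (-k) • w (k + j) = z ^ j • z ^ (-(k + j)) • w (k + j) := by
  rw [smul_smul, ← zpow_add₀ hz]
  congr 2
  ring

theorem hasSum_zpow_neg_smul_shift (hz : z ≠ 0) {w : ℤ → X} {S : X}
    (hw : HasSum (fun k : ℤ => z ^ (-k) • w k) S) (j : ℤ) :
    HasSum (fun k : ℤ => z ^ (-k) • w (k + j)) (z ^ j • S) := by
  simp_rw [zpow_neg_smul_shift hz w j]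
  exact ((Equiv.addRight j).hasSum_iff.mpr hw).const_smul _

theorem summable_norm_zpow_neg_smul_shift (hz : z ≠ 0) {w : ℤ → X}
    (hw : Summable fun k : ℤ => ‖z ^ (-k) • w k‖) (j : ℤ) :
    Summable fun k : ℤ => ‖z ^ (-k) • w (k + j)‖ := by
  simp_rw [zpow_neg_smul_shift hz w j, norm_smul (z ^ j)]
  exact ((Equiv.addRight j).summable_iff.mpr hw).mul_left _

end WeylConvolution


/-- `Z`-transform of the generalized Weyl `(a,m)`-fractional derivative:
if `∑ₛ |a(s)||z|^{-s} < ∞` and `∑ₖ ‖u(k)‖|z|^{-k} < ∞`, then `(Δ_{W,a}u)(k)` is given by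
an absolutely convergent series, the `Z`-transforms of `Δ_{W,a}u` and
`Δ_{W,a,m}u = Δᵐ(Δ_{W,a}u)` converge absolutely at `z`, and
`F_{Δ_{W,a,m}u}(z) = (∑_{j=0}^m (-1)^{m-j} C(m,j) z^j) F_a(z) F_u(z)`. -/
theorem zTransform_weyl_fractional_derivative
    (X : Type*) [NormedAddCommGroup X] [NormedSpace ℂ X] [CompleteSpace X]
    (m : ℕ) (hm : 1 ≤ m) (a : ℕ → ℂ) (u : ℤ → X) (z : ℂ) (hz : z ≠ 0)
    (ha : Summable (fun s : ℕ => ‖a s‖ * ‖z‖ ^ (-(s : ℤ))))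
    (hu : Summable (fun k : ℤ => ‖u k‖ * ‖z‖ ^ (-k))) :
    (∀ k : ℤ, Summable (fun s : ℕ => ‖a s‖ * ‖u (k - s)‖)) ∧
    Summable (fun k : ℤ => ‖∑' s : ℕ, a s • u (k - s)‖ * ‖z‖ ^ (-k)) ∧
    Summable (fun k : ℤ =>
      ‖∑ j ∈ Finset.range (m + 1), ((-1 : ℂ) ^ (m - j) * (m.choose j : ℂ)) •
          ∑' s : ℕ, a s • u (k + j - s)‖ * ‖z‖ ^ (-k)) ∧
    ∑' k : ℤ, z ^ (-k) •
        ∑ j ∈ Finset.range (m + 1), ((-1 : ℂ) ^ (m - j) * (m.choose j : ℂ)) •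
          ∑' s : ℕ, a s • u (k + j - s)
      = ((∑ j ∈ Finset.range (m + 1), (-1 : ℂ) ^ (m - j) * (m.choose j : ℂ) * z ^ (j : ℤ)) *
          ∑' s : ℕ, a s * z ^ (-(s : ℤ))) •
        ∑' k : ℤ, z ^ (-k) • u k := by
  have hnorm (k : ℤ) (x : X) : ‖z ^ (-k) • x‖ = ‖x‖ * ‖z‖ ^ (-k) := by
    rw [norm_smul, norm_zpow, mul_comm]
  have ha' : Summable fun s : ℕ => ‖a s * z ^ (-(s : ℤ))‖ := by
    simpa only [norm_mul, norm_zpow] using ha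
  have hu' : Summable fun k : ℤ => ‖z ^ (-k) • u k‖ := by simpa only [hnorm] using hu
  have hconv := summable_norm_weyl_convolution hz ha' hu'
  have hsum := hasSum_weyl_convolution hz ha' hu'
  refine ⟨fun k => ?_, ?_, ?_, ?_⟩
  · have h := (summable_norm_weyl_terms hz ha' hu').prod_factor k
    simp only [norm_smul (z ^ (-k))] at h
    rw [summable_mul_left_iff (norm_ne_zero_iff.mpr (zpow_ne_zero _ hz))] at h
    simpa only [norm_smul] using h
  · simpa only [hnorm] using hconv
  · simp_rw [← hnorm, Finset.smul_sum, smul_comm (z ^ (-(_ : ℤ)))]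
    refine Summable.of_nonneg_of_le (fun _ => norm_nonneg _) (fun _ => norm_sum_le _ _)
      (summable_sum fun j _ => ?_)
    simp_rw [norm_smul ((-1 : ℂ) ^ (m - j) * _)]
    exact (summable_norm_zpow_neg_smul_shift hz hconv j).mul_left _
  · simp_rw [Finset.smul_sum, smul_comm (z ^ (-(_ : ℤ)))]
    rw [(hasSum_sum fun (j : ℕ) _ =>
      (hasSum_zpow_neg_smul_shift hz hsum j).const_smul _).tsum_eq]
    simp_rw [mul_smul _ (∑' s : ℕ, _), Finset.sum_smul, mul_smul _ (z ^ (_ : ℤ))]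
end

section
/- Let X be a complex Banach space, s ∈ ℕ, let A₀, A₁, …, A_s be bounded linear operators on X, C a bounded linear operator on X, k₀, k₁, …, k_s ∈ ℤ, m₁, …, m_s ∈ ℕ, a_w : ℕ₀ → ℂ for 1 ≤ w ≤ s, and f : ℤ → X. Suppose there exists a nonempty open set Ω ⊆ ℂ∖{0} such that for every z ∈ Ω: (a) Σ_{j=0}^{∞} |a_w(j)| |z|^{−j} < ∞ for all 1 ≤ w ≤ s; and (b) the bounded operator Σ_{w=1}^{s} Σ_{j=0}^{m_w} (−1)^{m_w−j} C(m_w,j) z^{k_w+j} F_{a_w}(z) A_w + z^{k₀} A₀ is injective, where F_{a_w}(z) := Σ_{j=0}^{∞} a_w(j) z^{−j} and C(m,j) is the binomial coefficient. If u₁, u₂ : ℤ → X are two strong solutions of the equation A_s (Δ_{W,a_s,m_s} u)(k + k_s) + ⋯ + A₁ (Δ_{W,a₁,m₁} u)(k + k₁) + A₀ u(k + k₀) = C f(k) (k ∈ ℤ) — i.e., for each i and each 1 ≤ w ≤ s the series defining (Δ_{W,a_w} u_i)(k) converges absolutely for all k ∈ ℤ and the equation holds for all k ∈ ℤ — and if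 the Z-transforms F_{u₁}(z) and F_{u₂}(z) are absolutely convergent at every z ∈ Ω, then u₁ = u₂. -/
theorem hasSum_zTransform_weylConvolution {X : Type*} [NormedAddCommGroup X] [NormedSpace ℂ X]
    [CompleteSpace X] {a : ℕ → ℂ} {u : ℤ → X} {z : ℂ} (hz : z ≠ 0)
    (ha : Summable fun j : ℕ => ‖a j‖ * ‖z‖ ^ (-(j : ℤ)))
    (hu : Summable fun k : ℤ => ‖u k‖ * ‖z‖ ^ (-k)) (p : ℤ) :
    HasSum (fun k : ℤ => z ^ (-k) • ∑' t : ℕ, a t • u (k + p - t))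
      ((z ^ p * ∑' t : ℕ, a t * z ^ (-(t : ℤ))) • ∑' k : ℤ, z ^ (-k) • u k) := by
  have ha' : Summable fun t : ℕ => ‖a t * z ^ (-(t : ℤ))‖ := by simpa using ha
  have hu' : Summable fun k : ℤ => ‖z ^ (-k) • u k‖ := by
    simpa [norm_smul, mul_comm] using hu
  have hprod := ha'.mul_of_nonneg hu' (fun _ => norm_nonneg _) (fun _ => norm_nonneg _)
  have hG := ha'.of_norm.hasSum.smul hu'.of_norm.hasSum
    (.of_norm (hprod.congr fun x => (norm_smul _ _).symm))
  let e : ℤ × ℕ ≃ ℕ × ℤ :=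
    { toFun := fun x => (x.2, x.1 + p - x.2)
      invFun := fun x => (x.2 - p + x.1, x.1)
      left_inv := fun x => by ext <;> dsimp only; ring
      right_inv := fun x => by ext <;> dsimp only; ring }
  have hE := ((e.hasSum_iff.mpr hG).const_smul (z ^ p))
  rw [smul_smul] at hE
  have hterm : ∀ (k : ℤ) (t : ℕ), z ^ p • ((fun x : ℕ × ℤ =>
      (a x.1 * z ^ (-(x.1 : ℤ))) • (z ^ (-x.2) • u x.2)) ∘ e) (k, t) =
      z ^ (-k) • (a t • u (k + p - t)) := by
    intro k t
    simp only [Function.comp, e, Equiv.coe_fn_mk, smul_smul]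
    congr 1
    rw [show -(k + p - (t : ℤ)) = -k + (-p) + t by ring, zpow_add₀ hz, zpow_add₀ hz, zpow_neg z p,
      zpow_neg z (t : ℤ)]
    have := zpow_ne_zero p hz
    have := zpow_ne_zero (t : ℤ) hz
    field_simp
  refine (hE.prod_fiberwise fun k => (hE.summable.prod_factor k).hasSum).congr_fun fun k => ?_
  simp only [hterm, tsum_const_smul'']

theorem eq_zero_of_tsum_exp_smul_eq_zero {X : Type*} [NormedAddCommGroup X] [NormedSpace ℂ X]
    [CompleteSpace X] {d : ℤ → X} (hd : Summable fun k => ‖d k‖)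
    (hzero : ∀ θ : ℝ, ∑' k : ℤ, Complex.exp (-k * Complex.I * θ) • d k = 0) : d = 0 := by
  funext n
  have hexp : ∀ (k : ℤ) (θ : ℝ), ‖Complex.exp (k * Complex.I * θ)‖ = 1 := by
    intro k θ
    simp [Complex.norm_exp]
  have hint : HasSum
      (fun k : ℤ => ∫ θ in (0 : ℝ)..2 * Real.pi,
        Complex.exp ((n - k : ℤ) * Complex.I * θ) • d k)
      (∫ _ in (0 : ℝ)..2 * Real.pi, (0 : X)) := by
    refine intervalIntegral.hasSum_integral_of_dominated_convergence (fun k _ => ‖d k‖)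
      (fun k => Continuous.aestronglyMeasurable (by fun_prop)) ?_ ?_ ?_ ?_
    · intro k
      refine .of_forall fun θ _ => ?_
      rw [norm_smul, hexp, one_mul]
    · exact .of_forall fun _ _ => hd
    · exact intervalIntegrable_const
    · refine .of_forall fun θ _ => ?_
      have hs : Summable fun k : ℤ => Complex.exp ((n - k : ℤ) * Complex.I * θ) • d k :=
        .of_norm (by simpa only [norm_smul, hexp, one_mul] using hd)
      convert hs.hasSum
      have h := congrArg (Complex.exp (n * Complex.I * θ) • ·) (hzero θ)
      simp only [smul_zero, ← tsum_const_smul'', smul_smul, ← Complex.exp_add] at h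
      rw [← h]
      refine tsum_congr fun k => ?_
      congr 2
      push_cast
      ring
  have hoff : ∀ k, k ≠ n → (∫ θ in (0 : ℝ)..2 * Real.pi,
      Complex.exp ((n - k : ℤ) * Complex.I * θ) • d k) = 0 := by
    intro k hk
    have hne : ((n - k : ℤ) : ℂ) * Complex.I ≠ 0 :=
      mul_ne_zero (Int.cast_ne_zero.mpr (sub_ne_zero.mpr hk.symm)) Complex.I_ne_zero
    rw [intervalIntegral.integral_smul_const, integral_exp_mul_complex hne]
    have : Complex.exp ((n - k : ℤ) * Complex.I * (2 * Real.pi : ℝ)) = 1 := by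
      rw [Complex.exp_eq_one_iff]
      exact ⟨n - k, by push_cast; ring⟩
    rw [this]
    simp
  have h := hint.unique (hasSum_single n hoff)
  simpa [Real.pi_ne_zero] using h.symm

theorem eq_zero_of_tsum_zpow_smul_eq_zero {X : Type*} [NormedAddCommGroup X] [NormedSpace ℂ X]
    [CompleteSpace X] {c : ℤ → X} {Ω : Set ℂ} (hne : Ω.Nonempty) (hopen : IsOpen Ω)
    (hΩ : ∀ z ∈ Ω, z ≠ 0) (hc : ∀ z ∈ Ω, Summable fun k : ℤ => ‖c k‖ * ‖z‖ ^ (-k))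
    (hzero : ∀ z ∈ Ω, ∑' k : ℤ, z ^ (-k) • c k = 0) : c = 0 := by
  obtain ⟨z₀, hz₀⟩ := hne
  obtain ⟨w₀, rfl⟩ : ∃ w, Complex.exp w = z₀ := ⟨_, Complex.exp_log (hΩ _ hz₀)⟩
  obtain ⟨ε, hε, hball⟩ := Metric.isOpen_iff.mp (hopen.preimage Complex.continuous_exp) w₀ hz₀
  have hexp : ∀ (w : ℂ) (k : ℤ), ‖Complex.exp w ^ (-k)‖ = Real.exp (-k * w.re) := by
    intro w k
    rw [← Complex.exp_int_mul, Complex.norm_exp]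
    simp
  have hsum : ∀ x : ℝ, |x| < ε →
      Summable fun k : ℤ => ‖c k‖ * Real.exp (-k * (w₀.re + x)) := by
    intro x hx
    have := hc _ (hball (show w₀ + x ∈ Metric.ball w₀ ε by simpa using hx))
    simpa only [← norm_zpow, hexp, Complex.add_re, Complex.ofReal_re] using this
  let S : Set ℂ := Complex.re ⁻¹' Set.Ioo (w₀.re - ε / 2) (w₀.re + ε / 2)
  have hSo : IsOpen S := isOpen_Ioo.preimage Complex.continuous_re
  have hSc : IsPreconnected S :=
    ((convex_Ioo _ _).is_linear_preimage Complex.reLm.isLinear).isPreconnected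
  let b : ℤ → ℝ := fun k => ‖c k‖ * Real.exp (-k * (w₀.re + (-(ε / 2)))) +
    ‖c k‖ * Real.exp (-k * (w₀.re + ε / 2))
  have hb : Summable b :=
    (hsum _ (by rw [abs_neg, abs_of_pos] <;> linarith)).add
      (hsum _ (by rw [abs_of_pos] <;> linarith))
  have hle : ∀ (k : ℤ) (w : ℂ), w ∈ S → ‖Complex.exp w ^ (-k) • c k‖ ≤ b k := by
    intro k w hw
    rw [norm_smul, hexp, mul_comm, show b k = _ from (mul_add _ _ _).symm]
    refine mul_le_mul_of_nonneg_left ?_ (norm_nonneg _)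
    obtain ⟨h1, h2⟩ : w₀.re - ε / 2 < w.re ∧ w.re < w₀.re + ε / 2 := hw
    rcases le_total 0 k with hk | hk
    · have hk' : (0 : ℝ) ≤ k := by exact_mod_cast hk
      refine le_add_of_le_of_nonneg (Real.exp_le_exp.mpr ?_) (Real.exp_pos _).le
      nlinarith
    · have hk' : (k : ℝ) ≤ 0 := by exact_mod_cast hk
      refine le_add_of_nonneg_of_le (Real.exp_pos _).le (Real.exp_le_exp.mpr ?_)
      nlinarith
  have hd : DifferentiableOn ℂ (fun w => ∑' k : ℤ, Complex.exp w ^ (-k) • c k) S := by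
    refine Complex.differentiableOn_tsum_of_summable_norm hb (fun k => ?_) hSo hle
    simp only [← Complex.exp_int_mul]
    fun_prop
  have hS0 : w₀ ∈ S := by
    constructor <;> linarith
  have hzeroS := (hd.analyticOnNhd hSo).eqOn_zero_of_preconnected_of_eventuallyEq_zero hSc hS0
    (Filter.eventually_of_mem (Metric.ball_mem_nhds w₀ hε) fun w hw => hzero _ (hball hw))
  have hd0 := eq_zero_of_tsum_exp_smul_eq_zero
    (d := fun k => Complex.exp w₀.re ^ (-k) • c k) ?_ ?_
  · funext n
    simpa [zpow_ne_zero, Complex.exp_ne_zero] using congrFun hd0 n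
  · have := hsum 0 (by simpa using hε)
    simpa only [norm_smul, hexp, Complex.ofReal_re, add_zero, mul_comm] using this
  · intro θ
    have hθ := hzeroS (x := w₀.re + θ * Complex.I) (by
      show _ ∈ Set.Ioo _ _
      simp [hε])
    rw [Pi.zero_apply] at hθ
    rw [← hθ]
    refine tsum_congr fun k => ?_
    rw [smul_smul, ← Complex.exp_int_mul, ← Complex.exp_int_mul, ← Complex.exp_add]
    congr 2
    push_cast
    ring

theorem hasSum_zTransform_multiTerm {X ι : Type*} [NormedAddCommGroup X] [NormedSpace ℂ X]
    [CompleteSpace X] [Fintype ι] (A₀ : X →L[ℂ] X) (A : ι → X →L[ℂ] X) (k₀ : ℤ) (kc : ι → ℤ)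
    (m : ι → ℕ) {a : ι → ℕ → ℂ} {u : ℤ → X} {z : ℂ} (hz : z ≠ 0)
    (ha : ∀ w, Summable fun j : ℕ => ‖a w j‖ * ‖z‖ ^ (-(j : ℤ)))
    (hu : Summable fun k : ℤ => ‖u k‖ * ‖z‖ ^ (-k)) :
    HasSum (fun k : ℤ => z ^ (-k) • ((∑ w, A w (∑ j ∈ Finset.range (m w + 1),
            ((-1 : ℂ) ^ (m w - j) * ((m w).choose j : ℂ)) •
              ∑' t : ℕ, a w t • u (k + kc w + j - t))) + A₀ (u (k + k₀))))
      ((∑ w, (∑ j ∈ Finset.range (m w + 1),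
            (-1 : ℂ) ^ (m w - j) * ((m w).choose j : ℂ) * z ^ (kc w + (j : ℤ)) *
              ∑' t : ℕ, a w t * z ^ (-(t : ℤ))) • A w + z ^ k₀ • A₀)
        (∑' k : ℤ, z ^ (-k) • u k)) := by
  have hu' : Summable fun k : ℤ => z ^ (-k) • u k :=
    .of_norm (by simpa [norm_smul, mul_comm] using hu)
  have h₀ : HasSum (fun k : ℤ => z ^ (-k) • A₀ (u (k + k₀)))
      ((z ^ k₀ • A₀) (∑' k : ℤ, z ^ (-k) • u k)) := by
    refine (((((Equiv.addRight k₀).hasSum_iff.mpr hu'.hasSum).mapL A₀).const_smul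
      (z ^ k₀))).congr_fun fun k => ?_
    simp only [Function.comp, Equiv.coe_addRight, map_smul, smul_smul, ← zpow_add₀ hz]
    congr 2
    ring
  have hw : ∀ w, HasSum (fun k : ℤ => z ^ (-k) • A w (∑ j ∈ Finset.range (m w + 1),
        ((-1 : ℂ) ^ (m w - j) * ((m w).choose j : ℂ)) •
          ∑' t : ℕ, a w t • u (k + kc w + j - t)))
      (((∑ j ∈ Finset.range (m w + 1),
        (-1 : ℂ) ^ (m w - j) * ((m w).choose j : ℂ) * z ^ (kc w + (j : ℤ)) *
          ∑' t : ℕ, a w t * z ^ (-(t : ℤ))) • A w) (∑' k : ℤ, z ^ (-k) • u k)) := by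
    intro w
    have h := (hasSum_sum fun j (_ : j ∈ Finset.range (m w + 1)) =>
      (hasSum_zTransform_weylConvolution hz (ha w) hu (kc w + j)).const_smul
        ((-1 : ℂ) ^ (m w - j) * ((m w).choose j : ℂ))).mapL (A w)
    convert h using 1
    · funext k
      rw [← map_smul, Finset.smul_sum]
      simp only [smul_comm (z ^ (-k)), add_assoc]
    · simp only [smul_smul, ← Finset.sum_smul, map_smul, smul_apply, mul_assoc]
  convert (hasSum_sum fun w (_ : w ∈ Finset.univ) => hw w).add h₀ using 1
  · funext k
    rw [smul_add, Finset.smul_sum]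
  · simp only [add_apply, sum_apply]

/-- Uniqueness of strong solutions of the abstract multi-term fractional
difference equation with generalized Weyl `(a,m)`-fractional derivatives
`A_s (Δ_{W,a_s,m_s}u)(k+k_s) + ⋯ + A₁ (Δ_{W,a₁,m₁}u)(k+k₁) + A₀ u(k+k₀) = C f(k)` on `ℤ`,
provided on a nonempty open set `Ω ⊆ ℂ∖{0}` the sequences `a_w` have absolutely
convergent `Z`-transforms and the operator
`∑_{w=1}^s ∑_{j=0}^{m_w} (-1)^{m_w-j} C(m_w,j) z^{k_w+j} F_{a_w}(z) A_w + z^{k₀} A₀`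
is injective: two strong solutions whose `Z`-transforms converge absolutely on `Ω`
coincide. -/
theorem multi_term_weyl_difference_uniqueness
    (X : Type*) [NormedAddCommGroup X] [NormedSpace ℂ X] [CompleteSpace X]
    (s : ℕ) (hs : 1 ≤ s)
    (A₀ : X →L[ℂ] X) (A : Fin s → X →L[ℂ] X) (C : X →L[ℂ] X)
    (k₀ : ℤ) (kc : Fin s → ℤ) (m : Fin s → ℕ) (a : Fin s → ℕ → ℂ)
    (f u₁ u₂ : ℤ → X)
    (Ω : Set ℂ) (hΩne : Ω.Nonempty) (hΩopen : IsOpen Ω) (hΩ0 : ∀ z ∈ Ω, z ≠ 0)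
    (ha : ∀ z ∈ Ω, ∀ w : Fin s, Summable (fun j : ℕ => ‖a w j‖ * ‖z‖ ^ (-(j : ℤ))))
    (hinj : ∀ z ∈ Ω, Function.Injective
      ⇑(∑ w : Fin s, (∑ j ∈ Finset.range (m w + 1),
            (-1 : ℂ) ^ (m w - j) * ((m w).choose j : ℂ) * z ^ (kc w + (j : ℤ)) *
              ∑' t : ℕ, a w t * z ^ (-(t : ℤ))) • A w
          + z ^ k₀ • A₀))
    (hsol₁ :
      (∀ w : Fin s, ∀ k : ℤ, Summable (fun t : ℕ => ‖a w t‖ * ‖u₁ (k - t)‖)) ∧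
      ∀ k : ℤ,
        (∑ w : Fin s, A w (∑ j ∈ Finset.range (m w + 1),
            ((-1 : ℂ) ^ (m w - j) * ((m w).choose j : ℂ)) •
              ∑' t : ℕ, a w t • u₁ (k + kc w + j - t)))
          + A₀ (u₁ (k + k₀)) = C (f k))
    (hsol₂ :
      (∀ w : Fin s, ∀ k : ℤ, Summable (fun t : ℕ => ‖a w t‖ * ‖u₂ (k - t)‖)) ∧
      ∀ k : ℤ,
        (∑ w : Fin s, A w (∑ j ∈ Finset.range (m w + 1),
            ((-1 : ℂ) ^ (m w - j) * ((m w).choose j : ℂ)) •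
              ∑' t : ℕ, a w t • u₂ (k + kc w + j - t)))
          + A₀ (u₂ (k + k₀)) = C (f k))
    (hZ₁ : ∀ z ∈ Ω, Summable (fun k : ℤ => ‖u₁ k‖ * ‖z‖ ^ (-k)))
    (hZ₂ : ∀ z ∈ Ω, Summable (fun k : ℤ => ‖u₂ k‖ * ‖z‖ ^ (-k))) :
    u₁ = u₂ := by
  have hsmul : ∀ {u : ℤ → X} {z : ℂ}, Summable (fun k : ℤ => ‖u k‖ * ‖z‖ ^ (-k)) →
      Summable fun k : ℤ => z ^ (-k) • u k := fun h =>
    .of_norm (by simpa [norm_smul, mul_comm] using h)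
  refine sub_eq_zero.mp (eq_zero_of_tsum_zpow_smul_eq_zero hΩne hΩopen hΩ0 ?_ ?_)
  · intro z hz
    refine ((hZ₁ z hz).add (hZ₂ z hz)).of_nonneg_of_le (fun k => by positivity) fun k => ?_
    rw [← add_mul]
    exact mul_le_mul_of_nonneg_right (norm_sub_le _ _) (by positivity)
  · intro z hz
    have h₁ := hasSum_zTransform_multiTerm A₀ A k₀ kc m (hΩ0 z hz) (ha z hz) (hZ₁ z hz)
    have h₂ := hasSum_zTransform_multiTerm A₀ A k₀ kc m (hΩ0 z hz) (ha z hz) (hZ₂ z hz)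
    simp only [hsol₁.2] at h₁
    simp only [hsol₂.2] at h₂
    have h := hinj z hz (h₁.unique h₂)
    simp only [Pi.sub_apply, smul_sub]
    rw [(hsmul (hZ₁ z hz)).tsum_sub (hsmul (hZ₂ z hz)), h, sub_self]
end
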